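/- Fix δ > 0, x ∈ 𝕋^d, μ ∈ P(𝕋^d), and for each p ∈ ℝ^d let v^δ(p,·) be the unique classical (C²) solution of δv(y) − tr(a D²v(y)) + H(x, y, p, Dv(y), μ) = 0 on 𝕋^d. Then for every i ∈ {1,…,d} the partial derivative ∂_{p_i} v^δ(p, y) exists for all (p,y), is continuous in (p,y), and for each fixed p the function w(y) = ∂_{p_i} v^δ(p, y) is the unique classical (C²) solution of the linearized equation δw(y) − tr(a D²w(y)) + D_qH(x, y, p, D_y v^δ(p,y), μ)·Dw(y) = −∂_{p_i}H(x, y, p, D_y v^δ(p,y), μ) on 𝕋^d. Moreover the mixed second derivatives D²_{p y}v^δ and D²_{y p}v^δ exist, are continuous, and coincide. -/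

import Mathlib

noncomputable section

open MeasureTheory Metric Filter
open scoped RealInnerProductSpace ENNReal Topology

instance : Fact ((0:ℝ) < 1) := ⟨one_pos⟩

/-- Euclidean space `ℝ^d`. -/
abbrev Euc (d : ℕ) := EuclideanSpace ℝ (Fin d)

/-- The flat torus `𝕋^d = ℝ^d/ℤ^d`, realized as a product of circles. -/
abbrev Torus (d : ℕ) := Fin d → AddCircle (1 : ℝ)

/-- Canonical projection `ℝ^d → 𝕋^d`. -/
def Torus.proj {d : ℕ} (y : Euc d) : Torus d := fun i => (y i : AddCircle (1 : ℝ))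

/-- The 1-Wasserstein distance between two (probability) measures on a metric
measurable space: the infimum over all couplings of the expected distance. -/
def W1 {X : Type*} [MeasurableSpace X] [PseudoMetricSpace X] (μ ν : Measure X) : ℝ :=
  ⨅ π : {π : Measure (X × X) //
      IsProbabilityMeasure π ∧ π.map Prod.fst = μ ∧ π.map Prod.snd = ν},
    ∫ z, dist z.1 z.2 ∂(π : Measure (X × X))

/-- `P(𝕋^d)`: Borel probability measures on the torus. -/
abbrev ProbT (d : ℕ) := ProbabilityMeasure (Torus d)

/-- 1-Wasserstein distance on `P(𝕋^d)`. -/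
def W1T {d : ℕ} (μ ν : ProbT d) : ℝ := W1 (μ : Measure (Torus d)) (ν : Measure (Torus d))

/-- Second partial derivative `∂²v/∂yᵢ∂yⱼ`. -/
def hess {d : ℕ} (v : Euc d → ℝ) (y : Euc d) (i j : Fin d) : ℝ :=
  iteratedFDeriv ℝ 2 v y ![EuclideanSpace.single i 1, EuclideanSpace.single j 1]

/-- `tr(a D²v)(y)` for a constant matrix `a`. -/
def trAH {d : ℕ} (a : Matrix (Fin d) (Fin d) ℝ) (v : Euc d → ℝ) (y : Euc d) : ℝ :=
  ∑ i, ∑ j, a i j * hess v y j i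

/-- The `ℤ^d`-periodic lift of a function on the torus. -/
def tlift {d : ℕ} (v : Torus d → ℝ) : Euc d → ℝ := fun y => v (Torus.proj y)

/-- `v : 𝕋^d → ℝ` is a classical (C²) solution of the discounted cell problem
`δ v(y) - tr(a D²v(y)) + H(x, y, p, Dv(y), μ) = 0` on `𝕋^d`. -/
def IsSol {d : ℕ} (a : Matrix (Fin d) (Fin d) ℝ)
    (H : Torus d → Torus d → Euc d → Euc d → ProbT d → ℝ)
    (δ : ℝ) (x : Torus d) (p : Euc d) (μ : ProbT d) (v : Torus d → ℝ) : Prop :=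
  ContDiff ℝ 2 (tlift v) ∧
  ∀ y : Euc d,
    δ * v (Torus.proj y) - trAH a (tlift v) y
      + H x (Torus.proj y) p (gradient (tlift v) y) μ = 0

/-- The linearized equation satisfied by `∂_{p_i} v^δ(p, ·)`:
`δw − tr(a D²w) + D_qH(x, y, p, D_y v^δ(p,y), μ)·Dw = −∂_{p_i}H(x, y, p, D_y v^δ(p,y), μ)`. -/
def LinSolP {d : ℕ} (a : Matrix (Fin d) (Fin d) ℝ)
    (H : Torus d → Torus d → Euc d → Euc d → ProbT d → ℝ)
    (δ : ℝ) (x : Torus d) (μ : ProbT d) (v : Euc d → Torus d → ℝ) (i : Fin d)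
    (p : Euc d) (u : Torus d → ℝ) : Prop :=
  ContDiff ℝ 2 (tlift u) ∧
  ∀ y : Euc d,
    δ * u (Torus.proj y) - trAH a (tlift u) y
      + ⟪gradient (fun q : Euc d => H x (Torus.proj y) p q μ)
            (gradient (tlift (v p)) y),
          gradient (tlift u) y⟫
      = - deriv (fun t : ℝ =>
          H x (Torus.proj y) (p + t • (EuclideanSpace.single i 1 : Euc d))
            (gradient (tlift (v p)) y) μ) 0

namespace Torus

variable {d : ℕ}

lemma proj_add (y k : Euc d) : proj (y + k) = proj y + proj k := by
  funext i
  simp [proj]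

lemma proj_surjective : Function.Surjective (proj : Euc d → Torus d) := by
  intro Y
  choose r hr using fun i => QuotientAddGroup.mk_surjective (Y i)
  exact ⟨WithLp.toLp 2 r, funext hr⟩

lemma isOpenQuotientMap_proj : IsOpenQuotientMap (proj : Euc d → Torus d) :=
  (IsOpenQuotientMap.piMap fun _ : Fin d =>
    (⟨QuotientAddGroup.mk_surjective, QuotientAddGroup.continuous_mk,
      QuotientAddGroup.isOpenMap_coe⟩ :
      IsOpenQuotientMap ((↑) : ℝ → AddCircle (1 : ℝ)))).comp
    (EuclideanSpace.equiv (Fin d) ℝ).toHomeomorph.isOpenQuotientMap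

/-- Every point of `ℝ^d` has an integer translate in a fixed compact set. -/
lemma exists_isCompact_translate (d : ℕ) :
    ∃ K : Set (Euc d), IsCompact K ∧ K.Nonempty ∧ ∀ y, ∃ k, proj k = 0 ∧ y + k ∈ K := by
  refine ⟨WithLp.toLp 2 '' (Set.univ.pi fun _ => Set.Icc (0 : ℝ) 1),
    (isCompact_univ_pi fun _ => isCompact_Icc).image (PiLp.continuous_toLp 2 _),
    ⟨_, 0, by simp [Pi.le_def], rfl⟩, fun y => ⟨WithLp.toLp 2 fun i => -(⌊y i⌋ : ℝ), ?_, ?_⟩⟩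
  · funext i
    simp only [proj, Pi.zero_apply]
    rw [AddCircle.coe_eq_zero_iff]
    exact ⟨-⌊y i⌋, by simp⟩
  · refine ⟨fun i => Int.fract (y i), fun i _ => ⟨Int.fract_nonneg _, (Int.fract_lt_one _).le⟩, ?_⟩
    ext i
    simp [Int.fract, sub_eq_add_neg]

/-- A function on `ℝ^d` is periodic when it is invariant under all integer translations. -/
def IsPeriodic {F : Type*} (u : Euc d → F) : Prop :=
  ∀ k, proj k = 0 → ∀ y, u (y + k) = u y

namespace IsPeriodic

variable {F G : Type*}

lemma tlift (v : Torus d → ℝ) : IsPeriodic (tlift v) := fun k hk y => by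
  simp [_root_.tlift, proj_add, hk]

lemma comp {u : Euc d → F} (hu : IsPeriodic u) (g : F → G) : IsPeriodic fun y => g (u y) :=
  fun k hk y => congrArg g (hu k hk y)

lemma fderiv [NormedAddCommGroup F] [NormedSpace ℝ F] {u : Euc d → F} (hu : IsPeriodic u) :
    IsPeriodic (fderiv ℝ u) := fun k hk y => by
  rw [← fderiv_comp_add_right]
  exact congrArg (fun f => _root_.fderiv ℝ f y) (funext (hu k hk))

lemma gradient {u : Euc d → ℝ} (hu : IsPeriodic u) : IsPeriodic (gradient u) :=
  hu.fderiv.comp _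

lemma translate {u : Euc d → F} (hu : IsPeriodic u) (z : Euc d) :
    IsPeriodic fun y => u (y + z) := fun k hk y => by
  simp only [add_right_comm y k z, hu k hk]

lemma sub [Sub F] {u v : Euc d → F} (hu : IsPeriodic u) (hv : IsPeriodic v) :
    IsPeriodic fun y => u y - v y :=
  fun k hk y => by simp only [hu k hk, hv k hk]

lemma exists_max {u : Euc d → ℝ} (hu : IsPeriodic u) (hc : Continuous u) :
    ∃ y₀, ∀ y, u y ≤ u y₀ := by
  obtain ⟨K, hK, hne, hcov⟩ := exists_isCompact_translate d
  obtain ⟨y₀, -, hy₀⟩ := hK.exists_isMaxOn hne hc.continuousOn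
  refine ⟨y₀, fun y => ?_⟩
  obtain ⟨k, hk, hyk⟩ := hcov y
  exact (hu k hk y) ▸ hy₀ hyk

lemma exists_bound [NormedAddCommGroup F] {u : Euc d → F} (hu : IsPeriodic u)
    (hc : Continuous u) : ∃ C, 0 ≤ C ∧ ∀ y, ‖u y‖ ≤ C := by
  obtain ⟨y₀, h⟩ := (hu.comp norm).exists_max hc.norm
  exact ⟨_, norm_nonneg _, h⟩

end IsPeriodic

end Torus

section SecondOrder

open scoped Matrix

variable {d : ℕ}

/-- The contraction `∑ᵢⱼ aᵢⱼ Q(eⱼ, eᵢ)` of a matrix with a bilinear form. -/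
def matTrace (a : Matrix (Fin d) (Fin d) ℝ) (Q : Euc d →L[ℝ] Euc d →L[ℝ] ℝ) : ℝ :=
  ∑ i, ∑ j, a i j * Q (EuclideanSpace.single j 1) (EuclideanSpace.single i 1)

lemma trAH_eq (a : Matrix (Fin d) (Fin d) ℝ) (u : Euc d → ℝ) (y : Euc d) :
    trAH a u y = matTrace a (fderiv ℝ (fderiv ℝ u) y) := by
  simp [trAH, matTrace, hess, iteratedFDeriv_two_apply]

lemma matTrace_sub (a : Matrix (Fin d) (Fin d) ℝ) (Q R : Euc d →L[ℝ] Euc d →L[ℝ] ℝ) :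
    matTrace a (Q - R) = matTrace a Q - matTrace a R := by
  simp [matTrace, mul_sub]

lemma matTrace_smul (a : Matrix (Fin d) (Fin d) ℝ) (t : ℝ) (Q : Euc d →L[ℝ] Euc d →L[ℝ] ℝ) :
    matTrace a (t • Q) = t * matTrace a Q := by
  simp [matTrace, Finset.mul_sum, mul_left_comm]

lemma continuous_matTrace (a : Matrix (Fin d) (Fin d) ℝ) : Continuous (matTrace a) := by
  unfold matTrace
  fun_prop

lemma matTrace_nonpos {a : Matrix (Fin d) (Fin d) ℝ} (ha : a.PosSemidef)
    {Q : Euc d →L[ℝ] Euc d →L[ℝ] ℝ} (hQ : ∀ ξ, Q ξ ξ ≤ 0) : matTrace a Q ≤ 0 := by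
  obtain ⟨B, rfl⟩ : ∃ B : Matrix (Fin d) (Fin d) ℝ, a = B.conjTranspose * B := by
    open scoped MatrixOrder Matrix.Norms.L2Operator in
    exact CStarAlgebra.nonneg_iff_eq_star_mul_self.mp ha.nonneg
  have : matTrace (B.conjTranspose * B) Q
      = ∑ k, Q (∑ j, B k j • EuclideanSpace.single j 1) (∑ i, B k i • EuclideanSpace.single i 1) := by
    simp only [matTrace, Matrix.mul_apply, map_sum, map_smul, sum_apply,
      smul_apply, smul_eq_mul, Finset.mul_sum, Finset.sum_mul,
      Matrix.conjTranspose_apply, star_trivial]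
    rw [Finset.sum_congr rfl fun i _ => Finset.sum_comm, Finset.sum_comm]
    refine Finset.sum_congr rfl fun k _ => Finset.sum_congr rfl fun i _ =>
      Finset.sum_congr rfl fun j _ => by ring
  rw [this]
  exact Finset.sum_nonpos fun k _ => hQ _

/-- A positive definite matrix stays positive semidefinite after subtracting a small multiple of
any rank-one projection. -/
lemma exists_posSemidef_sub {a : Matrix (Fin d) (Fin d) ℝ} (ha : a.PosDef) :
    ∃ c : ℝ, 0 < c ∧ ∀ e : Euc d, ‖e‖ = 1 →
      (a - c • Matrix.vecMulVec (⇑e) (⇑e)).PosSemidef := by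
  have hpos : ∀ ξ : Euc d, ξ ≠ 0 → 0 < ξ ⬝ᵥ (a *ᵥ ξ) := fun ξ hξ => by
    simpa using ha.dotProduct_mulVec_pos (x := ⇑ξ) (by simpa using hξ)
  obtain ⟨c, hc, hle⟩ : ∃ c : ℝ, 0 < c ∧ ∀ ξ : Euc d, c * ‖ξ‖ ^ 2 ≤ ξ ⬝ᵥ (a *ᵥ ξ) := by
    rcases subsingleton_or_nontrivial (Euc d) with hs | hs
    · exact ⟨1, one_pos, fun ξ => by simp [Subsingleton.elim ξ 0]⟩
    have hcont : Continuous fun ξ : Euc d => ξ ⬝ᵥ (a *ᵥ ξ) := by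
      simp only [dotProduct, Matrix.mulVec]
      fun_prop
    obtain ⟨ξ₀, h₀, hmin⟩ := (isCompact_sphere (0 : Euc d) 1).exists_isMinOn
      (NormedSpace.sphere_nonempty.2 zero_le_one) hcont.continuousOn
    refine ⟨_, hpos ξ₀ (ne_zero_of_mem_unit_sphere ⟨ξ₀, h₀⟩), fun ξ => ?_⟩
    rcases eq_or_ne ξ 0 with rfl | hξ
    · simp
    have hn : ‖ξ‖ ≠ 0 := norm_ne_zero_iff.2 hξ
    have h1 := hmin (show ‖ξ‖⁻¹ • ξ ∈ sphere (0 : Euc d) 1 by simp [norm_smul, hn])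
    simp only [WithLp.ofLp_smul, Matrix.mulVec_smul, smul_dotProduct,
      dotProduct_smul, smul_eq_mul, Set.mem_ofPred_eq] at h1
    calc _ ≤ ‖ξ‖⁻¹ * (‖ξ‖⁻¹ * (ξ ⬝ᵥ (a *ᵥ ξ))) * ‖ξ‖ ^ 2 := by gcongr
      _ = _ := by field_simp
  refine ⟨c, hc, fun e he => .of_dotProduct_mulVec_nonneg ?_ fun x => ?_⟩
  · refine ha.1.sub ?_
    ext i j
    simp [Matrix.vecMulVec_apply, mul_comm]
  · have h1 := hle (WithLp.toLp 2 x)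
    have h2 : (e ⬝ᵥ x) ^ 2 ≤ ‖WithLp.toLp 2 x‖ ^ 2 := by
      have := abs_real_inner_le_norm e (WithLp.toLp 2 x)
      rw [he, one_mul] at this
      have h3 : ⟪e, WithLp.toLp 2 x⟫ = e ⬝ᵥ x := by
        simp [EuclideanSpace.inner_eq_star_dotProduct, dotProduct_comm]
      rw [h3] at this
      exact sq_le_sq' (by linarith [neg_le_of_abs_le this]) (le_of_abs_le this)
    have h4 : star x ⬝ᵥ ((a - c • Matrix.vecMulVec (⇑e) (⇑e)) *ᵥ x)
        = x ⬝ᵥ (a *ᵥ x) - c * (e ⬝ᵥ x) ^ 2 := by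
      simp [Matrix.sub_mulVec, Matrix.smul_mulVec, Matrix.vecMulVec_mulVec, dotProduct_comm]
      exact Or.inl (by ring)
    rw [h4]
    have h5 := mul_le_mul_of_nonneg_left h2 hc.le
    simp only at h1
    linarith

lemma matTrace_vecMulVec (e : Euc d) (Q : Euc d →L[ℝ] Euc d →L[ℝ] ℝ) :
    matTrace (Matrix.vecMulVec (⇑e) (⇑e)) Q = Q e e := by
  have he : e = ∑ j, e j • EuclideanSpace.single j (1 : ℝ) := by
    ext i
    simp [Finset.sum_apply, Pi.single_apply]
  conv_rhs => rw [he]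
  simp only [matTrace, map_sum, map_smul, sum_apply,
      smul_apply, smul_eq_mul, Finset.mul_sum, Matrix.vecMulVec_apply]
  refine Finset.sum_congr rfl fun i _ => Finset.sum_congr rfl fun j _ => by ring

/-- Ellipticity in contracted form. -/
lemma exists_matTrace_le {a : Matrix (Fin d) (Fin d) ℝ} (ha : a.PosDef) :
    ∃ c : ℝ, 0 < c ∧ ∀ e : Euc d, ‖e‖ = 1 → ∀ Q : Euc d →L[ℝ] Euc d →L[ℝ] ℝ, (∀ ξ, Q ξ ξ ≤ 0) →
      matTrace a Q ≤ c * Q e e := by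
  obtain ⟨c, hc, h⟩ := exists_posSemidef_sub ha
  refine ⟨c, hc, fun e he Q hQ => ?_⟩
  have h1 := matTrace_nonpos (h e he) hQ
  have h2 : matTrace (a - c • Matrix.vecMulVec (⇑e) (⇑e)) Q = matTrace a Q - c * Q e e := by
    rw [← matTrace_vecMulVec]
    simp only [matTrace, Matrix.sub_apply, Matrix.smul_apply, smul_eq_mul, sub_mul,
      Finset.sum_sub_distrib, Finset.mul_sum, mul_assoc]
  linarith

/-- The second derivative test: at a local maximum the second derivative is nonpositive. -/
lemma IsLocalMax.second_deriv_nonpos {g g' : ℝ → ℝ} {g'' : ℝ} (hmax : IsLocalMax g 0)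
    (hg : ∀ᶠ s in 𝓝 0, HasDerivAt g (g' s) s) (hg' : HasDerivAt g' g'' 0) : g'' ≤ 0 := by
  by_contra! hpos
  have hd : deriv g =ᶠ[𝓝 0] g' := hg.mono fun s hs => hs.deriv
  have hdd : deriv (deriv g) 0 = g'' := by rw [hd.deriv_eq, hg'.deriv]
  have hmin := isLocalMin_of_deriv_deriv_pos (hdd ▸ hpos) hmax.deriv_eq_zero
    hg.self_of_nhds.continuousAt
  have hconst : g =ᶠ[𝓝 0] fun _ => g 0 := by
    filter_upwards [hmax, hmin] with s h1 h2 using le_antisymm h1 h2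
  have h0 : deriv g =ᶠ[𝓝 0] fun _ => 0 := by simpa using hconst.deriv
  have : deriv (deriv g) 0 = 0 := by simpa using h0.deriv_eq
  linarith

lemma hasDerivAt_line {F : Type*} [NormedAddCommGroup F] [NormedSpace ℝ F] {u : Euc d → F}
    (hu : Differentiable ℝ u) (y ξ : Euc d) (s : ℝ) :
    HasDerivAt (fun s : ℝ => u (y + s • ξ)) (fderiv ℝ u (y + s • ξ) ξ) s := by
  have h : HasDerivAt (fun s : ℝ => y + s • ξ) ξ s := by
    simpa using ((hasDerivAt_id s).smul_const ξ).const_add y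
  exact (hu _).hasFDerivAt.comp_hasDerivAt s h

lemma differentiable_of_contDiff_two {u : Euc d → ℝ} (hu : ContDiff ℝ 2 u) : Differentiable ℝ u :=
  hu.differentiable (by norm_num)

lemma contDiff_fderiv_of_contDiff_two {u : Euc d → ℝ} (hu : ContDiff ℝ 2 u) :
    ContDiff ℝ 1 (fderiv ℝ u) :=
  hu.fderiv_right (by norm_num)

lemma differentiable_fderiv_of_contDiff_two {u : Euc d → ℝ} (hu : ContDiff ℝ 2 u) :
    Differentiable ℝ (fderiv ℝ u) :=
  (contDiff_fderiv_of_contDiff_two hu).differentiable (by norm_num)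

lemma hasDerivAt_line_fderiv {u : Euc d → ℝ} (hu : ContDiff ℝ 2 u) (y ξ : Euc d) (s : ℝ) :
    HasDerivAt (fun s : ℝ => fderiv ℝ u (y + s • ξ) ξ)
      (fderiv ℝ (fderiv ℝ u) (y + s • ξ) ξ ξ) s := by
  simpa using (hasDerivAt_line (differentiable_fderiv_of_contDiff_two hu) y ξ s).clm_apply
    (hasDerivAt_const s ξ)

end SecondOrder

section Estimates

open Torus

variable {d : ℕ}

/-- Maximum principle for periodic functions. -/
lemma le_of_periodic_elliptic {a : Matrix (Fin d) (Fin d) ℝ} (ha : a.PosDef) {δ : ℝ} (hδ : 0 < δ)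
    {u : Euc d → ℝ} (hu : ContDiff ℝ 2 u) (hp : IsPeriodic u) {G : ℝ}
    (h : ∀ y, fderiv ℝ u y = 0 → δ * u y - trAH a u y ≤ G) (y : Euc d) : u y ≤ G / δ := by
  obtain ⟨y₀, hy₀⟩ := hp.exists_max hu.continuous
  have hmax : IsLocalMax u y₀ := Eventually.of_forall hy₀
  have htr : trAH a u y₀ ≤ 0 := by
    rw [trAH_eq]
    refine matTrace_nonpos ha.posSemidef fun ξ => ?_
    refine IsLocalMax.second_deriv_nonpos (g := fun s : ℝ => u (y₀ + s • ξ))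
      (Eventually.of_forall fun s => by simpa using hy₀ (y₀ + s • ξ))
      (Eventually.of_forall fun s => hasDerivAt_line (differentiable_of_contDiff_two hu) y₀ ξ s) ?_
    simpa using hasDerivAt_line_fderiv hu y₀ ξ 0
  have h1 := h y₀ hmax.fderiv_eq_zero
  refine (hy₀ y).trans ?_
  rw [le_div_iff₀ hδ]
  linarith

/-- Doubling of variables: a periodic function whose elliptic operator is bounded satisfies a
concave modulus of continuity. -/
lemma sub_le_of_abs_trAH_le {a : Matrix (Fin d) (Fin d) ℝ} {c : ℝ}
    (hc : ∀ e : Euc d, ‖e‖ = 1 → ∀ Q : Euc d →L[ℝ] Euc d →L[ℝ] ℝ, (∀ ξ, Q ξ ξ ≤ 0) →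
      matTrace a Q ≤ c * Q e e) (hc0 : 0 < c)
    {u : Euc d → ℝ} (hu : ContDiff ℝ 2 u) (hp : IsPeriodic u) {U F N r : ℝ}
    (hU : ∀ y, |u y| ≤ U) (hF : ∀ y, |trAH a u y| ≤ F) (hN : F < 4 * c * N)
    (hr : 0 < r) {x y : Euc d} (hxy : ‖x - y‖ ≤ r) :
    u x - u y ≤ (2 * U / r + N * r) * ‖x - y‖ - N * ‖x - y‖ ^ 2 := by
  set M := 2 * U / r + N * r with hM
  have hcu : Continuous u := hu.continuous
  obtain ⟨K, hK, hne, hcov⟩ := exists_isCompact_translate d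
  let Φ : Euc d × Euc d → ℝ := fun z =>
    u (z.1 + z.2) - u z.1 - (M * ‖z.2‖ - N * ‖z.2‖ ^ 2)
  have hΦ : Continuous Φ := by fun_prop
  obtain ⟨⟨y₀, z₀⟩, ⟨-, hz₀⟩, hmaxK⟩ := (hK.prod (isCompact_closedBall (0 : Euc d) r)).exists_isMaxOn
    (hne.prod ⟨0, by simp [hr.le]⟩) hΦ.continuousOn
  have hmax : ∀ y z, ‖z‖ ≤ r → Φ (y, z) ≤ Φ (y₀, z₀) := fun y z hz => by
    obtain ⟨k, hk, hyk⟩ := hcov y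
    have h1 := hmaxK (show (y + k, z) ∈ K ×ˢ closedBall (0 : Euc d) r from
      ⟨hyk, by simpa using hz⟩)
    have h2 : Φ (y + k, z) = Φ (y, z) := by
      simp only [Φ, add_right_comm y k z, hp k hk]
    exact h2 ▸ h1
  suffices h0 : Φ (y₀, z₀) ≤ 0 by
    have := (hmax y (x - y) hxy).trans h0
    simp only [Φ, add_sub_cancel] at this
    linarith
  by_contra! hpos
  have hz₀r : ‖z₀‖ ≤ r := by simpa using hz₀
  have hz0 : z₀ ≠ 0 := by
    rintro rfl
    simp [Φ] at hpos
  have hρ : 0 < ‖z₀‖ := norm_pos_iff.2 hz0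
  have hlt : ‖z₀‖ < r := by
    refine hz₀r.lt_of_ne fun h => ?_
    have h1 := abs_le.1 (hU (y₀ + z₀))
    have h2 := abs_le.1 (hU y₀)
    have h3 : M * r - N * r ^ 2 = 2 * U := by rw [hM]; field_simp; ring
    simp only [Φ, h, h3] at hpos
    linarith
  set ρ := ‖z₀‖ with hρdef
  set e : Euc d := ρ⁻¹ • z₀ with he
  have he1 : ‖e‖ = 1 := by rw [he, norm_smul, ← hρdef, norm_inv, Real.norm_of_nonneg hρ.le,
    inv_mul_cancel₀ hρ.ne']
  have hz₀e : z₀ = ρ • e := by rw [he, smul_smul, mul_inv_cancel₀ hρ.ne', one_smul]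
  have hud := differentiable_of_contDiff_two hu
  set Q := fderiv ℝ (fderiv ℝ u) (y₀ + z₀) - fderiv ℝ (fderiv ℝ u) y₀ with hQ
  have hQle : ∀ ξ, Q ξ ξ ≤ 0 := fun ξ => by
    refine IsLocalMax.second_deriv_nonpos
      (g := fun s : ℝ => u (y₀ + z₀ + s • ξ) - u (y₀ + s • ξ))
      (Eventually.of_forall fun s => ?_)
      (Eventually.of_forall fun s =>
        (hasDerivAt_line hud (y₀ + z₀) ξ s).sub (hasDerivAt_line hud y₀ ξ s)) ?_
    · have := hmax (y₀ + s • ξ) z₀ hz₀r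
      simp only [Φ, add_right_comm y₀ (s • ξ) z₀] at this
      simp only [zero_smul, add_zero]
      linarith
    · exact ((hasDerivAt_line_fderiv hu (y₀ + z₀) ξ 0).sub
        (hasDerivAt_line_fderiv hu y₀ ξ 0)).congr_deriv (by simp [hQ])
  have hQe : Q e e + 8 * N ≤ 0 := by
    refine IsLocalMax.second_deriv_nonpos
      (g := fun s : ℝ => u (y₀ + z₀ + s • e) - u (y₀ + s • -e)
        - (M * (ρ + 2 * s) - N * (ρ + 2 * s) ^ 2))
      (g' := fun s : ℝ => fderiv ℝ u (y₀ + z₀ + s • e) e - fderiv ℝ u (y₀ + s • -e) (-e)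
        - (M * 2 - N * (4 * (ρ + 2 * s))))
      ?_ (Eventually.of_forall fun s => ?_) ?_
    · have h1 : ∀ᶠ s : ℝ in 𝓝 0, 0 < ρ + 2 * s :=
        (by fun_prop : Continuous fun s : ℝ => ρ + 2 * s).continuousAt.eventually_const_lt
          (by simpa using hρ)
      have h2 : ∀ᶠ s : ℝ in 𝓝 0, ρ + 2 * s < r :=
        (by fun_prop : Continuous fun s : ℝ => ρ + 2 * s).continuousAt.eventually_lt_const
          (by simpa using hlt)
      filter_upwards [h1, h2] with s hs1 hs2
      have hn : ‖(ρ + 2 * s) • e‖ = ρ + 2 * s := by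
        rw [norm_smul, he1, mul_one, Real.norm_of_nonneg hs1.le]
      have := hmax (y₀ + s • -e) ((ρ + 2 * s) • e) (hn.trans_le hs2.le)
      have h3 : y₀ + s • -e + (ρ + 2 * s) • e = y₀ + z₀ + s • e := by
        rw [hz₀e]; module
      simp only [Φ, hn, h3, ← hρdef] at this
      simpa using this
    · refine ((hasDerivAt_line hud (y₀ + z₀) e s).sub (hasDerivAt_line hud y₀ (-e) s)).sub ?_
      have hl : HasDerivAt (fun s : ℝ => ρ + 2 * s) 2 s := by
        simpa using ((hasDerivAt_id s).const_mul 2).const_add ρ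
      refine ((hl.const_mul M).sub ((hl.pow 2).const_mul N)).congr_deriv ?_
      push_cast
      ring
    · have hl : HasDerivAt (fun s : ℝ => ρ + 2 * s) 2 0 := by
        simpa using ((hasDerivAt_id (0 : ℝ)).const_mul 2).const_add ρ
      refine (((hasDerivAt_line_fderiv hu (y₀ + z₀) e 0).sub
        (hasDerivAt_line_fderiv hu y₀ (-e) 0)).sub
          (((hl.const_mul 4).const_mul N).const_sub (M * 2))).congr_deriv ?_
      simp [hQ]; ring
  have h1 := hc e he1 Q hQle
  rw [hQ, matTrace_sub, ← trAH_eq, ← trAH_eq, ← hQ] at h1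
  have h2 := abs_le.1 (hF (y₀ + z₀))
  have h3 := abs_le.1 (hF y₀)
  nlinarith

/-- Interior gradient estimate with a free length scale `r`. -/
lemma exists_norm_fderiv_le {a : Matrix (Fin d) (Fin d) ℝ} (ha : a.PosDef) :
    ∃ κ : ℝ, 0 < κ ∧ ∀ u : Euc d → ℝ, ContDiff ℝ 2 u → IsPeriodic u → ∀ U F r : ℝ, 0 < r →
      (∀ y, |u y| ≤ U) → (∀ y, |trAH a u y| ≤ F) →
      ∀ y, ‖fderiv ℝ u y‖ ≤ 2 * U / r + κ * r * F := by
  obtain ⟨c, hc0, hc⟩ := exists_matTrace_le ha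
  refine ⟨(4 * c)⁻¹, by positivity, fun u hu hp U F r hr hU hF y => ?_⟩
  have hU0 : 0 ≤ U := (abs_nonneg _).trans (hU y)
  have hF0 : 0 ≤ F := (abs_nonneg _).trans (hF y)
  refine le_of_forall_pos_le_add fun ε hε => ?_
  set N := (4 * c)⁻¹ * F + ε / r with hN
  have hN0 : 0 < N := by positivity
  have hFN : F < 4 * c * N := by
    have : 4 * c * N = F + 4 * c * (ε / r) := by rw [hN]; field_simp
    rw [this]
    have : 0 < 4 * c * (ε / r) := by positivity
    linarith
  have key : ∀ x z : Euc d, ‖x - z‖ ≤ r → u x - u z ≤ (2 * U / r + N * r) * ‖x - z‖ :=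
    fun x z hxz => (sub_le_of_abs_trAH_le hc hc0 hu hp hU hF hFN hr hxz).trans
      (sub_le_self _ (by positivity))
  have : 2 * U / r + (4 * c)⁻¹ * r * F + ε = 2 * U / r + N * r := by
    rw [hN]; field_simp; ring
  rw [this]
  refine norm_fderiv_le_of_lip' ℝ (by positivity) ?_
  filter_upwards [closedBall_mem_nhds y hr] with x hx
  rw [mem_closedBall, dist_eq_norm] at hx
  rw [Real.norm_eq_abs, abs_le]
  have h1 := key x y hx
  have h2 := key y x (by rwa [norm_sub_rev])
  rw [norm_sub_rev] at h2
  constructor <;> linarith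

lemma trAH_sub {a : Matrix (Fin d) (Fin d) ℝ} {u v : Euc d → ℝ} (hu : ContDiff ℝ 2 u)
    (hv : ContDiff ℝ 2 v) (y : Euc d) :
    trAH a (fun y => u y - v y) y = trAH a u y - trAH a v y := by
  have h1 : fderiv ℝ (fun y => u y - v y) = fun y => fderiv ℝ u y - fderiv ℝ v y := funext fun y =>
    fderiv_fun_sub (differentiable_of_contDiff_two hu y) (differentiable_of_contDiff_two hv y)
  rw [trAH_eq, trAH_eq, trAH_eq, h1, fderiv_fun_sub (differentiable_fderiv_of_contDiff_two hu y)
    (differentiable_fderiv_of_contDiff_two hv y), matTrace_sub]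

lemma trAH_const_mul {a : Matrix (Fin d) (Fin d) ℝ} {u : Euc d → ℝ} (hu : ContDiff ℝ 2 u)
    (t : ℝ) (y : Euc d) : trAH a (fun y => t * u y) y = t * trAH a u y := by
  have h1 : fderiv ℝ (fun y => t * u y) = fun y => t • fderiv ℝ u y := funext fun y =>
    fderiv_const_mul (differentiable_of_contDiff_two hu y) t
  rw [trAH_eq, trAH_eq, h1, fderiv_fun_const_smul (differentiable_fderiv_of_contDiff_two hu y),
    matTrace_smul]

lemma trAH_translate (a : Matrix (Fin d) (Fin d) ℝ) (u : Euc d → ℝ) (z y : Euc d) :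
    trAH a (fun y => u (y + z)) y = trAH a u (y + z) := by
  have h1 : fderiv ℝ (fun y => u (y + z)) = fun y => fderiv ℝ u (y + z) :=
    funext fun y => fderiv_comp_add_right z
  rw [trAH_eq, trAH_eq, h1, fderiv_comp_add_right]

/-- Interior estimate for second derivatives with a free length scale `r`. -/
lemma exists_norm_fderiv_fderiv_le {a : Matrix (Fin d) (Fin d) ℝ} (ha : a.PosDef) :
    ∃ κ : ℝ, 0 < κ ∧ ∀ u : Euc d → ℝ, ContDiff ℝ 2 u → IsPeriodic u → ∀ U Λ r : ℝ, 0 < r →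
      (∀ y, ‖fderiv ℝ u y‖ ≤ U) → (∀ y z, |trAH a u y - trAH a u z| ≤ Λ * ‖y - z‖) →
      0 ≤ Λ → ∀ y, ‖fderiv ℝ (fderiv ℝ u) y‖ ≤ 2 * U / r + κ * r * Λ := by
  obtain ⟨κ, hκ, h⟩ := exists_norm_fderiv_le ha
  refine ⟨κ, hκ, fun u hu hp U Λ r hr hU hΛ hΛ0 y => ?_⟩
  have hU0 : 0 ≤ U := (norm_nonneg _).trans (hU y)
  refine norm_fderiv_le_of_lip' ℝ (by positivity) (Eventually.of_forall fun x => ?_)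
  obtain ⟨z, rfl⟩ : ∃ z, x = y + z := ⟨x - y, by simp⟩
  have htz : ContDiff ℝ 2 fun y => u (y + z) := hu.comp (contDiff_id.add contDiff_const)
  have h1 := h (fun y => u (y + z) - u y) (htz.sub hu) ((hp.translate z).sub hp) (U * ‖z‖)
    (Λ * ‖z‖) r hr (fun y => ?_) (fun y => ?_) y
  · rw [fderiv_fun_sub (differentiable_of_contDiff_two htz y)
      (differentiable_of_contDiff_two hu y), fderiv_comp_add_right] at h1
    refine h1.trans_eq ?_
    rw [add_sub_cancel_left]
    ring
  · have := convex_univ.norm_image_sub_le_of_norm_fderiv_le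
      (fun x _ => differentiable_of_contDiff_two hu x) (fun x _ => hU x)
      (Set.mem_univ y) (Set.mem_univ (y + z))
    simpa using this
  · rw [trAH_sub htz hu, trAH_translate]
    simpa using hΛ (y + z) y

/-- A priori `C¹` estimate for a linear elliptic inequality with bounded drift. -/
lemma exists_c1_estimate {a : Matrix (Fin d) (Fin d) ℝ} (ha : a.PosDef) {δ : ℝ} (hδ : 0 < δ)
    {B : ℝ} (hB : 0 ≤ B) :
    ∃ C : ℝ, 0 ≤ C ∧ ∀ u : Euc d → ℝ, ContDiff ℝ 2 u → IsPeriodic u → ∀ G : ℝ,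
      (∀ y, |δ * u y - trAH a u y| ≤ G + B * ‖fderiv ℝ u y‖) →
      ∀ y, |u y| ≤ C * G ∧ ‖fderiv ℝ u y‖ ≤ C * G := by
  obtain ⟨κ, hκ, h⟩ := exists_norm_fderiv_le ha
  set r := (2 * κ * (B + 1))⁻¹ with hr
  have hr0 : 0 < r := by positivity
  have hκr : κ * r * B ≤ 1 / 2 := by
    have : κ * r * (B + 1) = 1 / 2 := by rw [hr]; field_simp
    nlinarith [mul_pos hκ hr0]
  refine ⟨max (1 / δ) (4 / (δ * r) + 4 * κ * r), by positivity, fun u hu hp G hG => ?_⟩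
  have hsup : ∀ y, |u y| ≤ G / δ := fun y => by
    have hn : ContDiff ℝ 2 fun y => (-1) * u y := contDiff_const.mul hu
    rw [abs_le']
    refine ⟨le_of_periodic_elliptic ha hδ hu hp (fun y hy => ?_) y, ?_⟩
    · have := hG y
      rw [hy, norm_zero, mul_zero, add_zero] at this
      exact (le_abs_self _).trans this
    · have := le_of_periodic_elliptic ha hδ hn (hp.comp fun t => (-1) * t) (G := G)
        (fun y hy => ?_) y
      · simpa using this
      · rw [fderiv_const_mul (differentiable_of_contDiff_two hu y)] at hy
        have h1 := hG y
        rw [show fderiv ℝ u y = 0 by simpa using hy, norm_zero, mul_zero, add_zero] at h1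
        rw [trAH_const_mul hu]
        linarith [(abs_le.1 h1).1]
  have hG0 : 0 ≤ G := by
    have := (abs_nonneg _).trans (hsup 0)
    rw [le_div_iff₀ hδ] at this
    linarith
  obtain ⟨y₀, hy₀⟩ := (hp.fderiv.comp norm).exists_max
    (contDiff_fderiv_of_contDiff_two hu).continuous.norm
  have hF : ∀ y, |trAH a u y| ≤ 2 * G + B * ‖fderiv ℝ u y₀‖ := fun y => by
    have h1 := abs_le.1 (hG y)
    have h2 := hsup y
    rw [le_div_iff₀ hδ] at h2
    have h3 : |δ * u y| ≤ G := by rwa [abs_mul, abs_of_pos hδ, mul_comm]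
    have h4 := mul_le_mul_of_nonneg_left (hy₀ y) hB
    have h5 := abs_le.1 h3
    rw [abs_le]
    constructor <;> linarith
  have h1 := h u hu hp (G / δ) _ r hr0 hsup hF y₀
  have h2 : ‖fderiv ℝ u y₀‖ ≤ (4 / (δ * r) + 4 * κ * r) * G := by
    have h3 := mul_le_mul_of_nonneg_right hκr (norm_nonneg (fderiv ℝ u y₀))
    have h4 : 2 * (2 * (G / δ) / r) = 4 / (δ * r) * G := by field_simp; ring
    linarith
  refine fun y => ⟨(hsup y).trans ?_, (hy₀ y).trans (h2.trans ?_)⟩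
  · rw [div_eq_inv_mul, ← one_div]
    gcongr
    exact le_max_left _ _
  · gcongr
    exact le_max_right _ _

end Estimates

section CellProblem

open Torus

variable {d : ℕ}

lemma norm_gradient_sub (u v : Euc d → ℝ) (y z : Euc d) :
    ‖gradient u y - gradient v z‖ = ‖fderiv ℝ u y - fderiv ℝ v z‖ := by
  rw [gradient, gradient, ← map_sub, LinearIsometryEquiv.norm_map]

lemma norm_gradient (u : Euc d → ℝ) (y : Euc d) : ‖gradient u y‖ = ‖fderiv ℝ u y‖ := by
  rw [gradient, LinearIsometryEquiv.norm_map]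

lemma contDiff_gradient {u : Euc d → ℝ} (hu : ContDiff ℝ 2 u) : ContDiff ℝ 1 (gradient u) :=
  (InnerProductSpace.toDual ℝ (Euc d)).symm.toContinuousLinearEquiv.contDiff.comp
    (contDiff_fderiv_of_contDiff_two hu)

lemma norm_fderiv_gradient_sub {u v : Euc d → ℝ} (hu : ContDiff ℝ 2 u) (hv : ContDiff ℝ 2 v)
    (y ξ : Euc d) : ‖fderiv ℝ (gradient u) y ξ - fderiv ℝ (gradient v) y ξ‖
      = ‖(fderiv ℝ (fderiv ℝ u) y - fderiv ℝ (fderiv ℝ v) y) ξ‖ := by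
  have h : ∀ {w : Euc d → ℝ}, ContDiff ℝ 2 w → fderiv ℝ (gradient w) y ξ
      = (InnerProductSpace.toDual ℝ (Euc d)).symm (fderiv ℝ (fderiv ℝ w) y ξ) := fun {w} hw => by
    have := ((InnerProductSpace.toDual ℝ (Euc d)).symm.toContinuousLinearEquiv.hasFDerivAt).comp y
      (differentiable_fderiv_of_contDiff_two hw y).hasFDerivAt
    exact congrArg (fun L => L ξ) this.fderiv
  rw [h hu, h hv, ← map_sub, LinearIsometryEquiv.norm_map]
  rfl

lemma fderiv_sub_of_contDiff_two {u v : Euc d → ℝ} (hu : ContDiff ℝ 2 u) (hv : ContDiff ℝ 2 v)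
    (y : Euc d) : fderiv ℝ (fun y => u y - v y) y = fderiv ℝ u y - fderiv ℝ v y :=
  fderiv_fun_sub (differentiable_of_contDiff_two hu y) (differentiable_of_contDiff_two hv y)

lemma fderiv_fderiv_sub_of_contDiff_two {u v : Euc d → ℝ} (hu : ContDiff ℝ 2 u)
    (hv : ContDiff ℝ 2 v) (y : Euc d) :
    fderiv ℝ (fderiv ℝ fun y => u y - v y) y
      = fderiv ℝ (fderiv ℝ u) y - fderiv ℝ (fderiv ℝ v) y := by
  rw [funext (fderiv_sub_of_contDiff_two hu hv)]
  exact fderiv_fun_sub (differentiable_fderiv_of_contDiff_two hu y)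
    (differentiable_fderiv_of_contDiff_two hv y)

lemma exists_fderiv_lipschitz_of_isCompact {G : Type*} [NormedAddCommGroup G] [NormedSpace ℝ G]
    {h : G → ℝ} (hh : ContDiff ℝ 2 h) {K : Set G} (hK : IsCompact K) :
    ∃ M : ℝ, 0 ≤ M ∧ ∀ S ⊆ K, Convex ℝ S → ∀ w ∈ S, ∀ w' ∈ S,
      ‖fderiv ℝ h w' - fderiv ℝ h w‖ ≤ M * ‖w' - w‖ := by
  have hk : ContDiff ℝ 1 (fderiv ℝ h) := hh.fderiv_right (by norm_num)
  obtain ⟨M, hM⟩ := hK.exists_bound_of_continuousOn (hk.continuous_fderiv one_ne_zero).continuousOn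
  refine ⟨max M 0, le_max_right _ _, fun S hSK hS w hw w' hw' => ?_⟩
  exact hS.norm_image_sub_le_of_norm_fderiv_le (𝕜 := ℝ)
    (fun z _ => hk.differentiable one_ne_zero z)
    (fun z hz => (hM z (hSK hz)).trans (le_max_left _ _)) hw hw'

/-- The derivative of a `C²` function, periodic in its first variable, is Lipschitz in the second
variable on balls, uniformly in the first one. -/
lemma exists_fderiv_lipschitz_of_periodic {F : Type*} [NormedAddCommGroup F] [NormedSpace ℝ F]
    [ProperSpace F] {h : Euc d × F → ℝ} (hh : ContDiff ℝ 2 h)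
    (hp : ∀ k, proj k = 0 → ∀ y z, h (y + k, z) = h (y, z)) (R : ℝ) :
    ∃ M : ℝ, 0 ≤ M ∧ ∀ y, ∀ z z' : F, ‖z‖ ≤ R → ‖z'‖ ≤ R →
      ‖fderiv ℝ h (y, z') - fderiv ℝ h (y, z)‖ ≤ M * ‖z' - z‖ := by
  obtain ⟨K, hK, -, hcov⟩ := exists_isCompact_translate d
  obtain ⟨M, hM0, hM⟩ := exists_fderiv_lipschitz_of_isCompact hh
    (hK.prod (isCompact_closedBall (0 : F) R))
  have hper : ∀ k, proj k = 0 → ∀ y z, fderiv ℝ h (y + k, z) = fderiv ℝ h (y, z) :=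
    fun k hk y z => by
      have h1 : (fun w : Euc d × F => h (w + (k, 0))) = h := funext fun w => by
        rw [show w + (k, 0) = (w.1 + k, w.2) by ext1 <;> simp]
        exact hp k hk w.1 w.2
      have h2 := fderiv_comp_add_right (𝕜 := ℝ) (f := h) (x := (y, z)) (k, 0)
      rw [h1] at h2
      simpa using h2.symm
  refine ⟨M, hM0, fun y z z' hz hz' => ?_⟩
  obtain ⟨k, hk0, hyk⟩ := hcov y
  rw [← hper k hk0 y z, ← hper k hk0 y z']
  refine (hM ({y + k} ×ˢ closedBall (0 : F) R)
    (Set.prod_mono (Set.singleton_subset_iff.2 hyk) subset_rfl)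
    ((convex_singleton _).prod (convex_closedBall _ _)) (y + k, z) ⟨rfl, by simpa using hz⟩
    (y + k, z') ⟨rfl, by simpa using hz'⟩).trans_eq ?_
  simp [Prod.norm_mk]

/-- A family `V p` of periodic classical solutions of the discounted cell problem with
Hamiltonian `h(y, p, q)`, which is `C²`, periodic in `y` and globally Lipschitz in `(p, q)`. -/
structure IsCellFamily (a : Matrix (Fin d) (Fin d) ℝ) (δ B : ℝ)
    (h : Euc d × Euc d × Euc d → ℝ) (V : Euc d → Euc d → ℝ) : Prop where
  nonneg : 0 ≤ B
  contDiff_ham : ContDiff ℝ 2 h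
  periodic_ham : ∀ k, proj k = 0 → ∀ y z, h (y + k, z) = h (y, z)
  lipschitz_ham : ∀ y z z', |h (y, z) - h (y, z')| ≤ B * (‖z.1 - z'.1‖ + ‖z.2 - z'.2‖)
  contDiff : ∀ p, ContDiff ℝ 2 (V p)
  periodic : ∀ p, IsPeriodic (V p)
  eq : ∀ p y, δ * V p y - trAH a (V p) y + h (y, p, gradient (V p) y) = 0

namespace IsCellFamily

variable {a : Matrix (Fin d) (Fin d) ℝ} {δ B : ℝ} {h : Euc d × Euc d × Euc d → ℝ}
  {V : Euc d → Euc d → ℝ}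

lemma differentiable_ham (hV : IsCellFamily a δ B h V) : Differentiable ℝ h :=
  hV.contDiff_ham.differentiable (by norm_num)

lemma hasFDerivAt_ham_snd (hV : IsCellFamily a δ B h V) (y : Euc d) (z : Euc d × Euc d) :
    HasFDerivAt (fun z => h (y, z))
      ((fderiv ℝ h (y, z)).comp (ContinuousLinearMap.inr ℝ (Euc d) (Euc d × Euc d))) z :=
  (hV.differentiable_ham (y, z)).hasFDerivAt.comp z (hasFDerivAt_prodMk_right y z)

lemma abs_fderiv_ham_le (hV : IsCellFamily a δ B h V) (y : Euc d) (z ζ : Euc d × Euc d) :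
    |fderiv ℝ h (y, z) (0, ζ)| ≤ B * (‖ζ.1‖ + ‖ζ.2‖) := by
  have h1 : HasDerivAt (fun t : ℝ => h (y, z + t • ζ)) (fderiv ℝ h (y, z) (0, ζ)) 0 := by
    have hl : HasDerivAt (fun t : ℝ => z + t • ζ) ζ 0 := by
      simpa using ((hasDerivAt_id (0 : ℝ)).smul_const ζ).const_add z
    have := (hV.hasFDerivAt_ham_snd y (z + (0 : ℝ) • ζ)).comp_hasDerivAt 0 hl
    exact this.congr_deriv (by simp)
  have h2 := h1.le_of_lip' (C := B * (‖ζ.1‖ + ‖ζ.2‖))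
    (mul_nonneg hV.nonneg (by positivity)) (Eventually.of_forall fun t => ?_)
  · simpa using h2
  · have := hV.lipschitz_ham y (z + t • ζ) (z + (0 : ℝ) • ζ)
    simp only [zero_smul, add_zero, Prod.fst_add, Prod.snd_add, add_sub_cancel_left,
      Prod.smul_fst, Prod.smul_snd, norm_smul] at this
    simp only [zero_smul, add_zero, sub_zero, Real.norm_eq_abs] at this ⊢
    linarith

lemma exists_fderiv_ham_lipschitz (hV : IsCellFamily a δ B h V) (R : ℝ) :
    ∃ M : ℝ, 0 ≤ M ∧ ∀ y, ∀ z z' : Euc d × Euc d, ‖z‖ ≤ R → ‖z'‖ ≤ R →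
      ‖fderiv ℝ h (y, z') - fderiv ℝ h (y, z)‖ ≤ M * ‖z' - z‖ :=
  exists_fderiv_lipschitz_of_periodic hV.contDiff_ham hV.periodic_ham R

lemma ham_taylor (hV : IsCellFamily a δ B h V) {R M : ℝ}
    (hM : ∀ y, ∀ z z' : Euc d × Euc d, ‖z‖ ≤ R → ‖z'‖ ≤ R →
      ‖fderiv ℝ h (y, z') - fderiv ℝ h (y, z)‖ ≤ M * ‖z' - z‖) (hM0 : 0 ≤ M)
    (y : Euc d) {z z' : Euc d × Euc d} (hz : ‖z‖ ≤ R) (hz' : ‖z'‖ ≤ R) :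
    |h (y, z') - h (y, z) - fderiv ℝ h (y, z) (0, z' - z)| ≤ M * ‖z' - z‖ ^ 2 := by
  have hseg : segment ℝ z z' ⊆ closedBall (0 : Euc d × Euc d) R :=
    (convex_closedBall _ _).segment_subset (by simpa using hz) (by simpa using hz')
  have := (convex_segment z z').norm_image_sub_le_of_norm_hasFDerivWithin_le'
    (f := fun z => h (y, z)) (C := M * ‖z' - z‖)
    (φ := (fderiv ℝ h (y, z)).comp (ContinuousLinearMap.inr ℝ (Euc d) (Euc d × Euc d)))
    (fun ζ _ => (hV.hasFDerivAt_ham_snd y ζ).hasFDerivWithinAt) (fun ζ hζ => ?_)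
    (left_mem_segment ℝ z z') (right_mem_segment ℝ z z')
  · simpa [pow_two, mul_assoc] using this
  · rw [← ContinuousLinearMap.sub_comp]
    have hζR : ‖ζ‖ ≤ R := by simpa using hseg hζ
    have hζz : ‖ζ - z‖ ≤ ‖z' - z‖ := by
      obtain ⟨s, hs, rfl⟩ := (segment_eq_image' ℝ z z') ▸ hζ
      rw [add_sub_cancel_left, norm_smul, Real.norm_of_nonneg hs.1]
      exact mul_le_of_le_one_left (norm_nonneg _) hs.2
    refine (ContinuousLinearMap.opNorm_comp_le _ _).trans ?_
    calc _ ≤ (M * ‖z' - z‖) * 1 := by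
          gcongr
          · exact (hM y z ζ hz hζR).trans (by gcongr)
          · exact ContinuousLinearMap.norm_inr_le_one ℝ _ _
      _ = _ := mul_one _

/-- The solutions depend on `p` in a globally Lipschitz way, in `C¹` norm. -/
lemma exists_c1_lipschitz (hV : IsCellFamily a δ B h V) (ha : a.PosDef) (hδ : 0 < δ) :
    ∃ C : ℝ, 1 ≤ C ∧ ∀ p p' y, |V p' y - V p y| ≤ C * ‖p' - p‖ ∧
      ‖fderiv ℝ (V p') y - fderiv ℝ (V p) y‖ ≤ C * ‖p' - p‖ ∧
      ‖((p', gradient (V p') y) : Euc d × Euc d) - (p, gradient (V p) y)‖ ≤ C * ‖p' - p‖ := by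
  obtain ⟨C, hC, hest⟩ := exists_c1_estimate ha hδ hV.nonneg
  refine ⟨max 1 (C * B), le_max_left _ _, fun p p' y => ?_⟩
  have h1 := hest (fun y => V p' y - V p y) ((hV.contDiff p').sub (hV.contDiff p))
    ((hV.periodic p').sub (hV.periodic p)) (B * ‖p' - p‖) (fun y => ?_) y
  · rw [fderiv_sub_of_contDiff_two (hV.contDiff p') (hV.contDiff p), ← mul_assoc] at h1
    have h2 : C * B * ‖p' - p‖ ≤ max 1 (C * B) * ‖p' - p‖ := by
      gcongr; exact le_max_right _ _
    refine ⟨h1.1.trans h2, h1.2.trans h2, ?_⟩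
    rw [Prod.mk_sub_mk, Prod.norm_mk, norm_gradient_sub]
    refine max_le ?_ (h1.2.trans h2)
    exact le_mul_of_one_le_left (norm_nonneg _) (le_max_left _ _)
  · rw [trAH_sub (hV.contDiff p') (hV.contDiff p),
      fderiv_sub_of_contDiff_two (hV.contDiff p') (hV.contDiff p), ← norm_gradient_sub, ← mul_add]
    refine le_trans (le_of_eq ?_) (hV.lipschitz_ham y (p, gradient (V p) y)
      (p', gradient (V p') y) |>.trans_eq ?_)
    · congr 1
      linarith [hV.eq p y, hV.eq p' y]
    · rw [norm_sub_rev p, norm_sub_rev (gradient (V p) y)]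

lemma exists_norm_le (hV : IsCellFamily a δ B h V) (p : Euc d) :
    ∃ R : ℝ, 0 ≤ R ∧ ∀ y, ‖((p, gradient (V p) y) : Euc d × Euc d)‖ ≤ R := by
  obtain ⟨R, hR, h⟩ := (hV.periodic p).gradient.exists_bound
    (contDiff_gradient (hV.contDiff p)).continuous
  exact ⟨max ‖p‖ R, le_max_of_le_right hR, fun y => max_le_max le_rfl (h y)⟩

/-- Near a fixed `p`, the elliptic operator applied to `V p' - V p` is Lipschitz in `y` with a
constant of order `‖p' - p‖`. -/
lemma exists_trAH_lipschitz (hV : IsCellFamily a δ B h V) (ha : a.PosDef) (hδ : 0 < δ)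
    (p : Euc d) :
    ∃ C : ℝ, 0 ≤ C ∧ ∀ p', ‖p' - p‖ ≤ 1 → ∀ y z,
      |trAH a (fun y => V p' y - V p y) y - trAH a (fun y => V p' y - V p y) z|
        ≤ C * ‖p' - p‖ * ‖y - z‖ := by
  obtain ⟨C₁, hC₁, hlip⟩ := hV.exists_c1_lipschitz ha hδ
  obtain ⟨R, hR, hPR⟩ := hV.exists_norm_le p
  obtain ⟨M, hM0, hM⟩ := hV.exists_fderiv_ham_lipschitz (R + C₁)
  obtain ⟨D, hD0, hD⟩ := ((hV.periodic p).gradient.fderiv).exists_bound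
    ((contDiff_gradient (hV.contDiff p)).continuous_fderiv (by norm_num))
  obtain ⟨κ, hκ, hest⟩ := exists_norm_fderiv_fderiv_le ha
  have hB := hV.nonneg
  set X := δ * C₁ + M * C₁ * (1 + D) with hX
  have hX0 : 0 ≤ X := by positivity
  set r := (2 * κ * (B + 1))⁻¹ with hr
  have hr0 : 0 < r := by positivity
  have hκr : κ * r * B ≤ 1 / 2 := by
    have : κ * r * (B + 1) = 1 / 2 := by rw [hr]; field_simp
    nlinarith [mul_pos hκ hr0]
  refine ⟨X + B * (4 * C₁ / r + 2 * κ * r * X), by positivity, fun p' hp' => ?_⟩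
  have hu := hV.contDiff p
  have hu' := hV.contDiff p'
  have hsub := hu'.sub hu
  have hper := (hV.periodic p').sub (hV.periodic p)
  obtain ⟨y₀, hy₀⟩ := (hper.fderiv.fderiv.comp norm).exists_max
    ((contDiff_fderiv_of_contDiff_two hsub).continuous_fderiv (by norm_num)).norm
  set S := ‖fderiv ℝ (fderiv ℝ fun y => V p' y - V p y) y₀‖ with hS
  have hS0 : 0 ≤ S := by positivity
  set ε := ‖p' - p‖ with hε
  have hε0 : 0 ≤ ε := norm_nonneg _
  have hPR' : ∀ y, ‖((p', gradient (V p') y) : Euc d × Euc d)‖ ≤ R + C₁ := fun y => by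
    have h1 := (hlip p p' y).2.2
    have h2 := norm_le_norm_add_norm_sub' ((p', gradient (V p') y) : Euc d × Euc d)
      (p, gradient (V p) y)
    have h3 : C₁ * ε ≤ C₁ := mul_le_of_le_one_right (by linarith) hp'
    linarith [hPR y]
  have hcomp : ∀ q y, HasFDerivAt (fun y => h (y, q, gradient (V q) y))
      ((fderiv ℝ h (y, q, gradient (V q) y)).comp
        ((ContinuousLinearMap.id ℝ (Euc d)).prod ((0 : Euc d →L[ℝ] Euc d).prod
          (fderiv ℝ (gradient (V q)) y)))) y := fun q y =>
    (hV.differentiable_ham _).hasFDerivAt.comp y ((hasFDerivAt_id y).prodMk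
      ((hasFDerivAt_const q y).prodMk
        ((contDiff_gradient (hV.contDiff q)).differentiable (by norm_num) y).hasFDerivAt))
  have hham : ∀ y z, |(h (y, p', gradient (V p') y) - h (y, p, gradient (V p) y))
      - (h (z, p', gradient (V p') z) - h (z, p, gradient (V p) z))|
        ≤ (M * C₁ * (1 + D) * ε + B * S) * ‖y - z‖ := fun y z => by
    refine convex_univ.norm_image_sub_le_of_norm_hasFDerivWithin_le
      (f := fun y => h (y, p', gradient (V p') y) - h (y, p, gradient (V p) y))
      (fun y _ => ((hcomp p' y).sub (hcomp p y)).hasFDerivWithinAt) (fun y _ => ?_)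
      (Set.mem_univ z) (Set.mem_univ y)
    refine ContinuousLinearMap.opNorm_le_bound _ (by positivity) fun ξ => ?_
    have hdec : ((fderiv ℝ h (y, p', gradient (V p') y)).comp
        ((ContinuousLinearMap.id ℝ (Euc d)).prod ((0 : Euc d →L[ℝ] Euc d).prod
          (fderiv ℝ (gradient (V p')) y)))
        - (fderiv ℝ h (y, p, gradient (V p) y)).comp
        ((ContinuousLinearMap.id ℝ (Euc d)).prod ((0 : Euc d →L[ℝ] Euc d).prod
          (fderiv ℝ (gradient (V p)) y)))) ξ
        = (fderiv ℝ h (y, p', gradient (V p') y) - fderiv ℝ h (y, p, gradient (V p) y))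
            (ξ, 0, fderiv ℝ (gradient (V p)) y ξ)
          + fderiv ℝ h (y, p', gradient (V p') y)
            (0, 0, fderiv ℝ (gradient (V p')) y ξ - fderiv ℝ (gradient (V p)) y ξ) := by
      have : ((0, 0, fderiv ℝ (gradient (V p')) y ξ - fderiv ℝ (gradient (V p)) y ξ) :
          Euc d × Euc d × Euc d) = (ξ, 0, fderiv ℝ (gradient (V p')) y ξ)
            - (ξ, 0, fderiv ℝ (gradient (V p)) y ξ) := by simp
      rw [this, map_sub]
      simp
    rw [hdec]
    have h1 : ‖(fderiv ℝ h (y, p', gradient (V p') y) - fderiv ℝ h (y, p, gradient (V p) y))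
        (ξ, 0, fderiv ℝ (gradient (V p)) y ξ)‖ ≤ (M * (C₁ * ε)) * ((1 + D) * ‖ξ‖) := by
      refine (ContinuousLinearMap.le_opNorm _ _).trans ?_
      gcongr
      · refine (hM y _ _ ((hPR y).trans (by linarith)) (hPR' y)).trans ?_
        gcongr
        exact (hlip p p' y).2.2
      · have h2 := (fderiv ℝ (gradient (V p)) y).le_of_opNorm_le (hD y) ξ
        have h3 := mul_nonneg hD0 (norm_nonneg ξ)
        have h4 := norm_nonneg ξ
        simp only [Prod.norm_mk, norm_zero]
        refine max_le (by linarith) (max_le (by linarith) (by linarith))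
    have h2 : ‖fderiv ℝ h (y, p', gradient (V p') y)
        (0, 0, fderiv ℝ (gradient (V p')) y ξ - fderiv ℝ (gradient (V p)) y ξ)‖
          ≤ B * (S * ‖ξ‖) := by
      refine (hV.abs_fderiv_ham_le y _ _).trans ?_
      simp only [norm_zero, zero_add]
      gcongr
      rw [norm_fderiv_gradient_sub hu' hu, ← fderiv_fderiv_sub_of_contDiff_two hu' hu]
      exact ContinuousLinearMap.le_of_opNorm_le _ (hy₀ y) ξ
    refine (norm_add_le _ _).trans ((add_le_add h1 h2).trans_eq ?_)
    ring
  have htr : ∀ y z, |trAH a (fun y => V p' y - V p y) y - trAH a (fun y => V p' y - V p y) z|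
      ≤ (X * ε + B * S) * ‖y - z‖ := fun y z => by
    have h1 : |(V p' y - V p y) - (V p' z - V p z)| ≤ C₁ * ε * ‖y - z‖ :=
      convex_univ.norm_image_sub_le_of_norm_fderiv_le (𝕜 := ℝ)
        (f := fun y => V p' y - V p y)
        (fun y _ => differentiable_of_contDiff_two hsub y) (fun y _ => by
          rw [fderiv_sub_of_contDiff_two hu' hu]
          exact (hlip p p' y).2.1) (Set.mem_univ z) (Set.mem_univ y)
    have h2 := hham y z
    have h3 : trAH a (fun y => V p' y - V p y) y - trAH a (fun y => V p' y - V p y) z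
        = δ * ((V p' y - V p y) - (V p' z - V p z))
          + ((h (y, p', gradient (V p') y) - h (y, p, gradient (V p) y))
            - (h (z, p', gradient (V p') z) - h (z, p, gradient (V p) z))) := by
      rw [trAH_sub hu' hu, trAH_sub hu' hu]
      linarith [hV.eq p y, hV.eq p' y, hV.eq p z, hV.eq p' z]
    rw [h3]
    refine (abs_add_le _ _).trans ?_
    rw [abs_mul, abs_of_pos hδ]
    have h4 := mul_le_mul_of_nonneg_left h1 hδ.le
    rw [hX]
    linarith
  have hSle := hest _ hsub hper (C₁ * ε) (X * ε + B * S) r hr0 (fun y => by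
    rw [fderiv_sub_of_contDiff_two hu' hu]
    exact (hlip p p' y).2.1) htr (by positivity) y₀
  have hSle' : S ≤ (4 * C₁ / r + 2 * κ * r * X) * ε := by
    have h3 := mul_le_mul_of_nonneg_right hκr hS0
    have h4 : 2 * (C₁ * ε) / r = (4 * C₁ / r) * ε / 2 := by ring
    rw [← hS, h4] at hSle
    linarith
  intro y z
  refine (htr y z).trans ?_
  gcongr
  have := mul_le_mul_of_nonneg_left hSle' hB
  linarith

end IsCellFamily

end CellProblem

section Differentiability

open Torus

variable {d : ℕ}

lemma exists_tendstoUniformly_of_uniformCauchySeqOn {ι X F : Type*} [UniformSpace F]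
    [CompleteSpace F] {l : Filter ι} [l.NeBot] {f : ι → X → F}
    (hf : UniformCauchySeqOn f l Set.univ) : ∃ g, TendstoUniformly f g l := by
  choose g hg using fun x => cauchy_map_iff_exists_tendsto.1 (hf.cauchy_map (Set.mem_univ x))
  exact ⟨g, tendstoUniformlyOn_univ.1 (hf.tendstoUniformlyOn_of_tendsto fun x _ => hg x)⟩

lemma exists_contDiff_two_limit {ι : Type*} {l : Filter ι} [l.NeBot] {w : ι → Euc d → ℝ}
    (hw : ∀ t, ContDiff ℝ 2 (w t)) (h0 : UniformCauchySeqOn w l Set.univ)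
    (h1 : UniformCauchySeqOn (fun t => fderiv ℝ (w t)) l Set.univ)
    (h2 : UniformCauchySeqOn (fun t => fderiv ℝ (fderiv ℝ (w t))) l Set.univ) :
    ∃ W : Euc d → ℝ, ContDiff ℝ 2 W ∧ ∀ y, Tendsto (fun t => w t y) l (𝓝 (W y)) ∧
      Tendsto (fun t => fderiv ℝ (w t) y) l (𝓝 (fderiv ℝ W y)) ∧
      Tendsto (fun t => fderiv ℝ (fderiv ℝ (w t)) y) l (𝓝 (fderiv ℝ (fderiv ℝ W) y)) := by
  obtain ⟨W, hW⟩ := exists_tendstoUniformly_of_uniformCauchySeqOn h0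
  obtain ⟨W₁, hW₁⟩ := exists_tendstoUniformly_of_uniformCauchySeqOn h1
  obtain ⟨W₂, hW₂⟩ := exists_tendstoUniformly_of_uniformCauchySeqOn h2
  have hd : ∀ y, HasFDerivAt W (W₁ y) y := hasFDerivAt_of_tendstoUniformly hW₁
    (fun t y => (differentiable_of_contDiff_two (hw t) y).hasFDerivAt)
    fun y => hW.tendsto_at y
  have hd₁ : ∀ y, HasFDerivAt W₁ (W₂ y) y := hasFDerivAt_of_tendstoUniformly hW₂
    (fun t y => (differentiable_fderiv_of_contDiff_two (hw t) y).hasFDerivAt)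
    fun y => hW₁.tendsto_at y
  have hc : Continuous W₂ := hW₂.continuous (Frequently.of_forall fun t =>
    (contDiff_fderiv_of_contDiff_two (hw t)).continuous_fderiv one_ne_zero)
  have e₁ : fderiv ℝ W = W₁ := funext fun y => (hd y).fderiv
  have e₂ : fderiv ℝ W₁ = W₂ := funext fun y => (hd₁ y).fderiv
  have hC₁ : ContDiff ℝ 1 W₁ :=
    contDiff_one_iff_fderiv.2 ⟨fun y => (hd₁ y).differentiableAt, e₂ ▸ hc⟩
  refine ⟨W, ?_, fun y => ⟨hW.tendsto_at y, e₁ ▸ hW₁.tendsto_at y, ?_⟩⟩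
  · rw [show (2 : WithTop ℕ∞) = 1 + 1 by norm_num, contDiff_succ_iff_fderiv]
    exact ⟨fun y => (hd y).differentiableAt, by simp, e₁ ▸ hC₁⟩
  · rw [e₁, e₂]
    exact hW₂.tendsto_at y

lemma uniformCauchySeqOn_of_le {F : Type*} [NormedAddCommGroup F] {f : ℝ → Euc d → F} {C : ℝ}
    (hC : 0 ≤ C) (hf : ∀ s t : ℝ, s ≠ 0 → t ≠ 0 → |s| ≤ 1 → |t| ≤ 1 → ∀ y, ∀ r > 0,
      ‖f t y - f s y‖ ≤ C * ((|t| + |s|) / r + r)) :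
    UniformCauchySeqOn f (𝓝[≠] 0) Set.univ := by
  intro u hu
  obtain ⟨ε, hε, hεu⟩ := Metric.mem_uniformity_dist.1 hu
  set r := ε / (4 * (C + 1)) with hr
  have hr0 : 0 < r := by positivity
  set η := min 1 (r ^ 2 / 2) with hη
  have hη0 : 0 < η := by positivity
  have hev : ∀ᶠ t : ℝ in 𝓝[≠] 0, t ≠ 0 ∧ |t| ≤ η := by
    refine eventually_mem_nhdsWithin.and (eventually_nhdsWithin_of_eventually_nhds ?_)
    filter_upwards [Metric.ball_mem_nhds (0 : ℝ) hη0] with t ht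
    simpa using (mem_ball_zero_iff.1 ht).le
  filter_upwards [hev.prod_mk hev] with st hst y _
  obtain ⟨⟨hs, hsη⟩, ht, htη⟩ := hst
  refine hεu ?_
  rw [dist_eq_norm]
  refine (hf st.2 st.1 ht hs (htη.trans (min_le_left _ _)) (hsη.trans (min_le_left _ _)) y r
    hr0).trans_lt ?_
  have h1 : (|st.1| + |st.2|) / r ≤ r := by
    rw [div_le_iff₀ hr0]
    have := min_le_right 1 (r ^ 2 / 2)
    nlinarith
  have h2 : (C + 1) * r = ε / 4 := by rw [hr]; field_simp
  nlinarith

lemma continuous_uncurry_of_lipschitz {X F : Type*} [TopologicalSpace X] [NormedAddCommGroup F]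
    {f : Euc d → X → F} (hf : ∀ p, Continuous (f p))
    (hlip : ∀ p, ∃ C : ℝ, ∀ p', ‖p' - p‖ ≤ 1 → ∀ y, ‖f p' y - f p y‖ ≤ C * ‖p' - p‖) :
    Continuous fun z : Euc d × X => f z.1 z.2 := by
  refine continuous_iff_continuousAt.2 fun ⟨p, y⟩ => ?_
  obtain ⟨C, hC⟩ := hlip p
  have h1 : Tendsto (fun z : Euc d × X => ‖z.1 - p‖) (𝓝 (p, y)) (𝓝 0) := by
    have : Continuous fun z : Euc d × X => ‖z.1 - p‖ := by fun_prop
    simpa using this.tendsto (p, y)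
  have h2 : Tendsto (fun z : Euc d × X => f p z.2) (𝓝 (p, y)) (𝓝 (f p y)) :=
    ((hf p).comp continuous_snd).tendsto (p, y)
  have h3 : Tendsto (fun z : Euc d × X => f z.1 z.2 - f p z.2) (𝓝 (p, y)) (𝓝 0) := by
    refine squeeze_zero_norm' ?_ (by simpa using h1.const_mul C)
    filter_upwards [h1.eventually_le_const one_pos] with z hz using hC z.1 hz z.2
  rw [ContinuousAt]
  simpa using h3.add h2

/-- The difference quotient of the family `V` at `p` in the direction `e`. -/
def diffQuot (V : Euc d → Euc d → ℝ) (p e : Euc d) (t : ℝ) : Euc d → ℝ :=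
  fun y => t⁻¹ * (V (p + t • e) y - V p y)

namespace IsCellFamily

variable {a : Matrix (Fin d) (Fin d) ℝ} {δ B : ℝ} {h : Euc d × Euc d × Euc d → ℝ}
  {V : Euc d → Euc d → ℝ}

lemma contDiff_diffQuot (hV : IsCellFamily a δ B h V) (p e : Euc d) (t : ℝ) :
    ContDiff ℝ 2 (diffQuot V p e t) :=
  contDiff_const.mul ((hV.contDiff _).sub (hV.contDiff p))

lemma periodic_diffQuot (hV : IsCellFamily a δ B h V) (p e : Euc d) (t : ℝ) :
    IsPeriodic (diffQuot V p e t) :=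
  ((hV.periodic _).sub (hV.periodic p)).comp fun s => t⁻¹ * s

lemma fderiv_diffQuot (hV : IsCellFamily a δ B h V) (p e : Euc d) (t : ℝ) (y : Euc d) :
    fderiv ℝ (diffQuot V p e t) y = t⁻¹ • (fderiv ℝ (V (p + t • e)) y - fderiv ℝ (V p) y) := by
  rw [← fderiv_sub_of_contDiff_two (hV.contDiff _) (hV.contDiff p)]
  exact fderiv_const_mul (differentiable_of_contDiff_two
    ((hV.contDiff _).sub (hV.contDiff p)) y) _

lemma gradient_diffQuot (hV : IsCellFamily a δ B h V) (p e : Euc d) (t : ℝ) (y : Euc d) :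
    gradient (diffQuot V p e t) y
      = t⁻¹ • (gradient (V (p + t • e)) y - gradient (V p) y) := by
  rw [gradient, hV.fderiv_diffQuot, map_smulₛₗ, map_sub]
  rfl

lemma trAH_diffQuot (hV : IsCellFamily a δ B h V) (p e : Euc d) (t : ℝ) (y : Euc d) :
    trAH a (diffQuot V p e t) y = t⁻¹ * trAH a (fun y => V (p + t • e) y - V p y) y :=
  trAH_const_mul ((hV.contDiff _).sub (hV.contDiff p)) _ y

lemma exists_diffQuot_residual (hV : IsCellFamily a δ B h V) (ha : a.PosDef) (hδ : 0 < δ)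
    (p : Euc d) {e : Euc d} (he : ‖e‖ = 1) :
    ∃ C : ℝ, 0 ≤ C ∧ ∀ t : ℝ, t ≠ 0 → |t| ≤ 1 → ∀ y,
      |δ * diffQuot V p e t y - trAH a (diffQuot V p e t) y
        + fderiv ℝ h (y, p, gradient (V p) y) (0, e, gradient (diffQuot V p e t) y)|
          ≤ C * |t| := by
  obtain ⟨C₁, hC₁, hlip⟩ := hV.exists_c1_lipschitz ha hδ
  obtain ⟨R, hR, hPR⟩ := hV.exists_norm_le p
  obtain ⟨M, hM0, hM⟩ := hV.exists_fderiv_ham_lipschitz (R + C₁)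
  refine ⟨M * C₁ ^ 2, by positivity, fun t ht ht1 y => ?_⟩
  have hε : ‖p + t • e - p‖ = |t| := by simp [norm_smul, he]
  have hl := (hlip p (p + t • e) y).2.2
  rw [hε] at hl
  have hP' : ‖((p + t • e, gradient (V (p + t • e)) y) : Euc d × Euc d)‖ ≤ R + C₁ := by
    have h2 := norm_le_norm_add_norm_sub'
      ((p + t • e, gradient (V (p + t • e)) y) : Euc d × Euc d) (p, gradient (V p) y)
    have h3 : C₁ * |t| ≤ C₁ := mul_le_of_le_one_right (by linarith) ht1
    linarith [hPR y]
  have hT := hV.ham_taylor hM hM0 y ((hPR y).trans (by linarith)) hP'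
  have hdir : ((0, e, gradient (diffQuot V p e t) y) : Euc d × Euc d × Euc d)
      = t⁻¹ • ((0 : Euc d), ((p + t • e, gradient (V (p + t • e)) y) : Euc d × Euc d)
          - (p, gradient (V p) y)) := by
    rw [hV.gradient_diffQuot]
    simp [smul_smul, ht]
  have hkey : δ * diffQuot V p e t y - trAH a (diffQuot V p e t) y
        + fderiv ℝ h (y, p, gradient (V p) y) (0, e, gradient (diffQuot V p e t) y)
      = -t⁻¹ * (h (y, p + t • e, gradient (V (p + t • e)) y) - h (y, p, gradient (V p) y)
        - fderiv ℝ h (y, p, gradient (V p) y)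
          (0, (p + t • e, gradient (V (p + t • e)) y) - (p, gradient (V p) y))) := by
    rw [hdir, map_smul, hV.trAH_diffQuot, trAH_sub (hV.contDiff _) (hV.contDiff p), smul_eq_mul,
      diffQuot]
    linear_combination t⁻¹ * hV.eq (p + t • e) y - t⁻¹ * hV.eq p y
  rw [hkey, abs_mul, abs_neg, abs_inv]
  have ht0 : 0 < |t| := abs_pos.2 ht
  calc _ ≤ |t|⁻¹ * (M * (C₁ * |t|) ^ 2) := by
        gcongr
        exact hT.trans (by gcongr)
    _ = M * C₁ ^ 2 * |t| := by field_simp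

lemma exists_diffQuot_sub_le (hV : IsCellFamily a δ B h V) (ha : a.PosDef) (hδ : 0 < δ)
    (p : Euc d) {e : Euc d} (he : ‖e‖ = 1) :
    ∃ C : ℝ, 0 ≤ C ∧ ∀ s t : ℝ, s ≠ 0 → t ≠ 0 → |s| ≤ 1 → |t| ≤ 1 → ∀ y,
      |diffQuot V p e t y - diffQuot V p e s y| ≤ C * (|t| + |s|) ∧
      ‖fderiv ℝ (diffQuot V p e t) y - fderiv ℝ (diffQuot V p e s) y‖ ≤ C * (|t| + |s|) ∧
      ∀ r > 0, ‖fderiv ℝ (fderiv ℝ (diffQuot V p e t)) y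
        - fderiv ℝ (fderiv ℝ (diffQuot V p e s)) y‖ ≤ C * ((|t| + |s|) / r + r) := by
  obtain ⟨C₁, hC₁, hres⟩ := hV.exists_diffQuot_residual ha hδ p he
  obtain ⟨C₂, hC₂, hest⟩ := exists_c1_estimate ha hδ hV.nonneg
  obtain ⟨C₃, hC₃, hlip⟩ := hV.exists_trAH_lipschitz ha hδ p
  obtain ⟨κ, hκ, hest₂⟩ := exists_norm_fderiv_fderiv_le ha
  have htr : ∀ t : ℝ, t ≠ 0 → |t| ≤ 1 → ∀ y z,
      |trAH a (diffQuot V p e t) y - trAH a (diffQuot V p e t) z| ≤ C₃ * ‖y - z‖ :=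
    fun t ht ht1 y z => by
      have hε : ‖p + t • e - p‖ = |t| := by simp [norm_smul, he]
      have h1 := hlip (p + t • e) (hε.trans_le ht1) y z
      rw [hε] at h1
      have ht0 : 0 < |t| := abs_pos.2 ht
      rw [hV.trAH_diffQuot, hV.trAH_diffQuot, ← mul_sub, abs_mul, abs_inv]
      calc _ ≤ |t|⁻¹ * (C₃ * |t| * ‖y - z‖) := by gcongr
        _ = C₃ * ‖y - z‖ := by field_simp
  have hb : 0 ≤ C₂ * C₁ := by positivity
  have hk : 0 ≤ κ * C₃ := by positivity
  refine ⟨2 * (C₂ * C₁) + 2 * (κ * C₃), by positivity, fun s t hs ht hs1 ht1 => ?_⟩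
  have hwt := hV.contDiff_diffQuot p e t
  have hws := hV.contDiff_diffQuot p e s
  have hsub := hwt.sub hws
  have hper := (hV.periodic_diffQuot p e t).sub (hV.periodic_diffQuot p e s)
  have hts : 0 ≤ |t| + |s| := by positivity
  have h1 := hest _ hsub hper (C₁ * (|t| + |s|)) fun y => by
    have e1 := hres t ht ht1 y
    have e2 := hres s hs hs1 y
    have e3 := hV.abs_fderiv_ham_le y (p, gradient (V p) y)
      (0, gradient (diffQuot V p e t) y - gradient (diffQuot V p e s) y)
    rw [norm_zero, zero_add, norm_gradient_sub, ← fderiv_sub_of_contDiff_two hwt hws] at e3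
    have e4 : ((0, 0, gradient (diffQuot V p e t) y - gradient (diffQuot V p e s) y) :
        Euc d × Euc d × Euc d) = (0, e, gradient (diffQuot V p e t) y)
          - (0, e, gradient (diffQuot V p e s) y) := by simp
    rw [e4, map_sub] at e3
    rw [trAH_sub hwt hws]
    rw [abs_le] at e1 e2 e3 ⊢
    constructor <;> linarith [e1.1, e1.2, e2.1, e2.2, e3.1, e3.2]
  intro y
  have hle : C₂ * (C₁ * (|t| + |s|))
      ≤ (2 * (C₂ * C₁) + 2 * (κ * C₃)) * (|t| + |s|) := by
    rw [← mul_assoc]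
    gcongr
    linarith
  refine ⟨(h1 y).1.trans hle, ?_, fun r hr => ?_⟩
  · rw [← fderiv_sub_of_contDiff_two hwt hws]
    exact (h1 y).2.trans hle
  · have h2 := hest₂ _ hsub hper (C₂ * (C₁ * (|t| + |s|))) (2 * C₃) r hr (fun y => (h1 y).2)
      (fun y z => by
        have e1 := htr t ht ht1 y z
        have e2 := htr s hs hs1 y z
        rw [trAH_sub hwt hws, trAH_sub hwt hws]
        rw [abs_le] at e1 e2 ⊢
        constructor <;> linarith [e1.1, e1.2, e2.1, e2.2]) (by positivity) y
    rw [← fderiv_fderiv_sub_of_contDiff_two hwt hws]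
    refine h2.trans ?_
    have e1 : 0 ≤ C₂ * C₁ * r := by positivity
    have e2 : 0 ≤ κ * C₃ * ((|t| + |s|) / r) := by positivity
    have e3 : 2 * (C₂ * (C₁ * (|t| + |s|))) / r = 2 * (C₂ * C₁) * ((|t| + |s|) / r) := by ring
    rw [e3]
    linarith

/-- The difference quotients converge in `C²` to a solution of the linearized equation. -/
lemma exists_limit_diffQuot (hV : IsCellFamily a δ B h V) (ha : a.PosDef) (hδ : 0 < δ)
    (p : Euc d) {e : Euc d} (he : ‖e‖ = 1) :
    ∃ W : Euc d → ℝ, ContDiff ℝ 2 W ∧ IsPeriodic W ∧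
      (∀ y, Tendsto (fun t => diffQuot V p e t y) (𝓝[≠] 0) (𝓝 (W y))) ∧
      (∀ y, Tendsto (fun t => fderiv ℝ (diffQuot V p e t) y) (𝓝[≠] 0) (𝓝 (fderiv ℝ W y))) ∧
      ∀ y, δ * W y - trAH a W y
        + fderiv ℝ h (y, p, gradient (V p) y) (0, e, gradient W y) = 0 := by
  obtain ⟨C, hC, hest⟩ := hV.exists_diffQuot_sub_le ha hδ p he
  have hmono : ∀ s t r : ℝ, |s| ≤ 1 → |t| ≤ 1 → 0 < r →
      C * (|t| + |s|) ≤ 2 * C * ((|t| + |s|) / r + r) := fun s t r hs ht hr => by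
    have h1 : |t| + |s| ≤ 2 * ((|t| + |s|) / r + r) := by
      rcases le_total r 1 with h | h
      · have := le_div_self (by positivity : 0 ≤ |t| + |s|) hr h
        have : 0 ≤ |t| + |s| := by positivity
        linarith
      · have : 0 ≤ (|t| + |s|) / r := by positivity
        linarith
    calc _ ≤ C * (2 * ((|t| + |s|) / r + r)) := by gcongr
      _ = _ := by ring
  have hC2 : 0 ≤ 2 * C := by positivity
  obtain ⟨W, hW, hlim⟩ := exists_contDiff_two_limit (w := diffQuot V p e) (l := 𝓝[≠] 0)
    (hV.contDiff_diffQuot p e)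
    (uniformCauchySeqOn_of_le hC2 fun s t hs ht hs1 ht1 y r hr =>
      (hest s t hs ht hs1 ht1 y).1.trans (hmono s t r hs1 ht1 hr))
    (uniformCauchySeqOn_of_le hC2 fun s t hs ht hs1 ht1 y r hr =>
      (hest s t hs ht hs1 ht1 y).2.1.trans (hmono s t r hs1 ht1 hr))
    (uniformCauchySeqOn_of_le (F := Euc d →L[ℝ] Euc d →L[ℝ] ℝ) hC
      fun s t hs ht hs1 ht1 y r hr => (hest s t hs ht hs1 ht1 y).2.2 r hr)
  refine ⟨W, hW, fun k hk y => ?_, fun y => (hlim y).1, fun y => (hlim y).2.1, fun y => ?_⟩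
  · refine tendsto_nhds_unique (hlim (y + k)).1 ((hlim y).1.congr fun t => ?_)
    exact (hV.periodic_diffQuot p e t k hk y).symm
  · obtain ⟨C', hC', hres⟩ := hV.exists_diffQuot_residual ha hδ p he
    have h1 : Tendsto (fun t => trAH a (diffQuot V p e t) y) (𝓝[≠] 0) (𝓝 (trAH a W y)) := by
      simp only [trAH_eq]
      exact ((continuous_matTrace a).tendsto _).comp (hlim y).2.2
    have h2 : Tendsto (fun t => gradient (diffQuot V p e t) y) (𝓝[≠] 0) (𝓝 (gradient W y)) :=
      (((InnerProductSpace.toDual ℝ (Euc d)).symm.continuous).tendsto _).comp (hlim y).2.1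
    have h3 : Tendsto (fun t => fderiv ℝ h (y, p, gradient (V p) y)
        (0, e, gradient (diffQuot V p e t) y)) (𝓝[≠] 0)
        (𝓝 (fderiv ℝ h (y, p, gradient (V p) y) (0, e, gradient W y))) :=
      ((fderiv ℝ h (y, p, gradient (V p) y)).continuous.tendsto _).comp
        (tendsto_const_nhds.prodMk_nhds (tendsto_const_nhds.prodMk_nhds h2))
    have h4 := (((hlim y).1.const_mul δ).sub h1).add h3
    refine tendsto_nhds_unique h4 (squeeze_zero_norm' (a := fun t : ℝ => C' * |t|) ?_ ?_)
    · have hev : ∀ᶠ t : ℝ in 𝓝[≠] 0, |t| ≤ 1 := by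
        refine eventually_nhdsWithin_of_eventually_nhds ?_
        filter_upwards [Metric.ball_mem_nhds (0 : ℝ) one_pos] with t ht
        simpa using (mem_ball_zero_iff.1 ht).le
      filter_upwards [hev, eventually_mem_nhdsWithin] with t ht ht0 using hres t ht0 ht y
    · have : Continuous fun t : ℝ => C' * |t| := by fun_prop
      simpa using (this.tendsto 0).mono_left nhdsWithin_le_nhds

/-- Solutions of the linearized equations depend on `p` in a locally Lipschitz way. -/
lemma exists_linearized_lipschitz (hV : IsCellFamily a δ B h V) (ha : a.PosDef) (hδ : 0 < δ)
    {e : Euc d} (he : ‖e‖ = 1) {W : Euc d → Euc d → ℝ} (hW : ∀ p, ContDiff ℝ 2 (W p))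
    (hWp : ∀ p, IsPeriodic (W p)) (hWe : ∀ p y, δ * W p y - trAH a (W p) y
      + fderiv ℝ h (y, p, gradient (V p) y) (0, e, gradient (W p) y) = 0) (p : Euc d) :
    ∃ C : ℝ, ∀ p', ‖p' - p‖ ≤ 1 → ∀ y, |W p' y - W p y| ≤ C * ‖p' - p‖ ∧
      ‖fderiv ℝ (W p') y - fderiv ℝ (W p) y‖ ≤ C * ‖p' - p‖ := by
  obtain ⟨C₁, hC₁, hlip⟩ := hV.exists_c1_lipschitz ha hδ
  obtain ⟨R, hR, hPR⟩ := hV.exists_norm_le p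
  obtain ⟨M, hM0, hM⟩ := hV.exists_fderiv_ham_lipschitz (R + C₁)
  obtain ⟨C₂, hC₂, hest⟩ := exists_c1_estimate ha hδ hV.nonneg
  have hB := hV.nonneg
  have hWb : ∀ p y, ‖fderiv ℝ (W p) y‖ ≤ C₂ * B := fun p y => by
    refine (hest (W p) (hW p) (hWp p) B (fun y => ?_) y).2
    have h1 := hV.abs_fderiv_ham_le y (p, gradient (V p) y) (e, gradient (W p) y)
    rw [norm_gradient, he] at h1
    rw [eq_neg_of_add_eq_zero_left (hWe p y), abs_neg]
    linarith
  refine ⟨C₂ * (M * C₁ * (1 + C₂ * B)), fun p' hp' y => ?_⟩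
  have hz := hest _ ((hW p').sub (hW p)) ((hWp p').sub (hWp p))
    (M * C₁ * (1 + C₂ * B) * ‖p' - p‖) (fun y => ?_) y
  · rw [fderiv_sub_of_contDiff_two (hW p') (hW p), ← mul_assoc] at hz
    exact hz
  · have hl := (hlip p p' y).2.2
    have hP' : ‖((p', gradient (V p') y) : Euc d × Euc d)‖ ≤ R + C₁ := by
      have h2 := norm_le_norm_add_norm_sub' ((p', gradient (V p') y) : Euc d × Euc d)
        (p, gradient (V p) y)
      have h3 : C₁ * ‖p' - p‖ ≤ C₁ := mul_le_of_le_one_right (by linarith) hp'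
      linarith [hPR y]
    have h1 : |(fderiv ℝ h (y, p', gradient (V p') y) - fderiv ℝ h (y, p, gradient (V p) y))
        (0, e, gradient (W p') y)| ≤ M * (C₁ * ‖p' - p‖) * (1 + C₂ * B) := by
      refine ((fderiv ℝ h (y, p', gradient (V p') y)
        - fderiv ℝ h (y, p, gradient (V p) y)).le_opNorm _).trans ?_
      gcongr
      · refine (hM y _ _ ((hPR y).trans (by linarith)) hP').trans ?_
        gcongr
      · have h2 := hWb p' y
        have h3 : 0 ≤ C₂ * B := by positivity
        rw [Prod.norm_mk, Prod.norm_mk, norm_zero, he, norm_gradient]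
        refine max_le (by linarith) (max_le (by linarith) (by linarith))
    have h2 := hV.abs_fderiv_ham_le y (p, gradient (V p) y)
      (0, gradient (W p') y - gradient (W p) y)
    rw [norm_zero, zero_add, norm_gradient_sub,
      ← fderiv_sub_of_contDiff_two (hW p') (hW p)] at h2
    have h3 : ((0, 0, gradient (W p') y - gradient (W p) y) : Euc d × Euc d × Euc d)
        = (0, e, gradient (W p') y) - (0, e, gradient (W p) y) := by simp
    rw [h3, map_sub] at h2
    rw [sub_apply] at h1
    rw [trAH_sub (hW p') (hW p)]
    have e1 := hWe p y
    have e2 := hWe p' y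
    rw [abs_le] at h1 h2 ⊢
    constructor <;> linarith [h1.1, h1.2, h2.1, h2.2]

lemma eq_of_linearized (hV : IsCellFamily a δ B h V) (ha : a.PosDef) (hδ : 0 < δ)
    {p e : Euc d} {u w : Euc d → ℝ} (hu : ContDiff ℝ 2 u) (hw : ContDiff ℝ 2 w)
    (hup : IsPeriodic u) (hwp : IsPeriodic w)
    (hue : ∀ y, δ * u y - trAH a u y
      + fderiv ℝ h (y, p, gradient (V p) y) (0, e, gradient u y) = 0)
    (hwe : ∀ y, δ * w y - trAH a w y
      + fderiv ℝ h (y, p, gradient (V p) y) (0, e, gradient w y) = 0) (y : Euc d) :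
    u y = w y := by
  obtain ⟨C₂, hC₂, hest⟩ := exists_c1_estimate ha hδ hV.nonneg
  have hz := (hest _ (hu.sub hw) (hup.sub hwp) 0 (fun y => ?_) y).1
  · rw [mul_zero] at hz
    exact sub_eq_zero.1 (abs_nonpos_iff.1 hz)
  · have h2 := hV.abs_fderiv_ham_le y (p, gradient (V p) y)
      (0, gradient u y - gradient w y)
    rw [norm_zero, zero_add, norm_gradient_sub, ← fderiv_sub_of_contDiff_two hu hw] at h2
    have h3 : ((0, 0, gradient u y - gradient w y) : Euc d × Euc d × Euc d)
        = (0, e, gradient u y) - (0, e, gradient w y) := by simp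
    rw [h3, map_sub] at h2
    rw [trAH_sub hu hw]
    have e1 := hue y
    have e2 := hwe y
    rw [abs_le] at h2 ⊢
    constructor <;> linarith [h2.1, h2.2]

end IsCellFamily

end Differentiability

section Hamiltonian

open Torus

variable {d : ℕ}

lemma Torus.IsPeriodic.exists_tlift_eq {u : Euc d → ℝ} (hu : IsPeriodic u) :
    ∃ U : Torus d → ℝ, _root_.tlift U = u := by
  obtain ⟨s, hs⟩ := proj_surjective.hasRightInverse (f := (proj : Euc d → Torus d))
  refine ⟨fun Y => u (s Y), funext fun y => ?_⟩
  have h0 : proj (y - s (proj y)) = 0 := by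
    have := proj_add (s (proj y)) (y - s (proj y))
    rwa [add_sub_cancel, hs, left_eq_add] at this
  have := hu _ h0 (s (proj y))
  rw [add_sub_cancel] at this
  exact this.symm

lemma abs_sSup_image_sub_le {α : Type*} {A : Set α} {φ ψ : α → ℝ} (hφ : BddAbove (φ '' A))
    (hψ : BddAbove (ψ '' A)) {K : ℝ} (hK : 0 ≤ K) (h : ∀ α ∈ A, |φ α - ψ α| ≤ K) :
    |sSup (φ '' A) - sSup (ψ '' A)| ≤ K := by
  rcases A.eq_empty_or_nonempty with rfl | hA
  · simpa using hK
  · have h1 : sSup (φ '' A) ≤ sSup (ψ '' A) + K := by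
      refine csSup_le (hA.image φ) ?_
      rintro _ ⟨α, hα, rfl⟩
      have := le_csSup hψ ⟨α, hα, rfl⟩
      linarith [(abs_le.1 (h α hα)).2]
    have h2 : sSup (ψ '' A) ≤ sSup (φ '' A) + K := by
      refine csSup_le (hA.image ψ) ?_
      rintro _ ⟨α, hα, rfl⟩
      have := le_csSup hφ ⟨α, hα, rfl⟩
      linarith [(abs_le.1 (h α hα)).1]
    exact abs_le.2 ⟨by linarith, by linarith⟩

/-- A Bellman Hamiltonian is Lipschitz in the momenta, uniformly in the space variable. -/
lemma exists_bellman_lipschitz {X E : Type*} [TopologicalSpace X] [CompactSpace X]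
    [TopologicalSpace E] {A : Set E} (hA : IsCompact A) {c f : X → E → Euc d} {L : X → E → ℝ}
    (hc : Continuous fun z : X × E => c z.1 z.2) (hf : Continuous fun z : X × E => f z.1 z.2)
    (hL : Continuous fun z : X × E => L z.1 z.2) :
    ∃ B : ℝ, 0 ≤ B ∧ ∀ y, ∀ z z' : Euc d × Euc d,
      |sSup ((fun α => -⟪z.1, c y α⟫ - ⟪z.2, f y α⟫ - L y α) '' A)
        - sSup ((fun α => -⟪z'.1, c y α⟫ - ⟪z'.2, f y α⟫ - L y α) '' A)|
          ≤ B * (‖z.1 - z'.1‖ + ‖z.2 - z'.2‖) := by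
  obtain ⟨B₁, hB₁⟩ := (isCompact_univ.prod hA).exists_bound_of_continuousOn hc.continuousOn
  obtain ⟨B₂, hB₂⟩ := (isCompact_univ.prod hA).exists_bound_of_continuousOn hf.continuousOn
  have hB : 0 ≤ max (max B₁ B₂) 0 := le_max_right _ _
  refine ⟨max (max B₁ B₂) 0, hB, fun y z z' => ?_⟩
  have hbdd : ∀ z : Euc d × Euc d,
      BddAbove ((fun α => -⟪z.1, c y α⟫ - ⟪z.2, f y α⟫ - L y α) '' A) := fun z => by
    have e1 : Continuous fun α => c y α := hc.comp (Continuous.prodMk_right y)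
    have e2 : Continuous fun α => f y α := hf.comp (Continuous.prodMk_right y)
    have e3 : Continuous fun α => L y α := hL.comp (Continuous.prodMk_right y)
    exact hA.bddAbove_image (by fun_prop)
  refine abs_sSup_image_sub_le (hbdd z) (hbdd z') (by positivity) fun α hα => ?_
  have e1 : -⟪z.1, c y α⟫ - ⟪z.2, f y α⟫ - L y α - (-⟪z'.1, c y α⟫ - ⟪z'.2, f y α⟫ - L y α)
      = -(⟪z.1 - z'.1, c y α⟫ + ⟪z.2 - z'.2, f y α⟫) := by
    rw [inner_sub_left, inner_sub_left]
    ring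
  rw [e1, abs_neg]
  refine (abs_add_le _ _).trans ?_
  have e2 := abs_real_inner_le_norm (z.1 - z'.1) (c y α)
  have e3 := abs_real_inner_le_norm (z.2 - z'.2) (f y α)
  have e4 : ‖z.1 - z'.1‖ * ‖c y α‖ ≤ ‖z.1 - z'.1‖ * max (max B₁ B₂) 0 := by
    gcongr
    exact (hB₁ (y, α) ⟨trivial, hα⟩).trans ((le_max_left _ _).trans (le_max_left _ _))
  have e5 : ‖z.2 - z'.2‖ * ‖f y α‖ ≤ ‖z.2 - z'.2‖ * max (max B₁ B₂) 0 := by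
    gcongr
    exact (hB₂ (y, α) ⟨trivial, hα⟩).trans ((le_max_right _ _).trans (le_max_left _ _))
  linarith

namespace IsCellFamily

variable {a : Matrix (Fin d) (Fin d) ℝ} {δ B : ℝ} {h : Euc d × Euc d × Euc d → ℝ}
  {V : Euc d → Euc d → ℝ}

lemma inner_gradient_ham (hV : IsCellFamily a δ B h V) (y p q ξ : Euc d) :
    ⟪gradient (fun q => h (y, p, q)) q, ξ⟫ = fderiv ℝ h (y, p, q) (0, 0, ξ) := by
  rw [gradient, InnerProductSpace.toDual_symm_apply]
  have := (hV.hasFDerivAt_ham_snd y (p, q)).comp q (hasFDerivAt_prodMk_right p q)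
  exact congrArg (fun T => T ξ) this.fderiv

lemma deriv_ham (hV : IsCellFamily a δ B h V) (y p q e : Euc d) :
    deriv (fun t : ℝ => h (y, p + t • e, q)) 0 = fderiv ℝ h (y, p, q) (0, e, 0) := by
  have hl : HasDerivAt (fun t : ℝ => (p + t • e, q)) (e, (0 : Euc d)) 0 := by
    refine HasDerivAt.prodMk ?_ (hasDerivAt_const _ _)
    simpa using ((hasDerivAt_id (0 : ℝ)).smul_const e).const_add p
  have := (hV.hasFDerivAt_ham_snd y (p + (0 : ℝ) • e, q)).comp_hasDerivAt 0 hl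
  rw [zero_smul, add_zero] at this
  exact this.deriv

lemma linearized_iff (hV : IsCellFamily a δ B h V) (p e : Euc d) (u : Euc d → ℝ) (y : Euc d) :
    δ * u y - trAH a u y
        + ⟪gradient (fun q => h (y, p, q)) (gradient (V p) y), gradient u y⟫
      = -deriv (fun t : ℝ => h (y, p + t • e, gradient (V p) y)) 0 ↔
    δ * u y - trAH a u y + fderiv ℝ h (y, p, gradient (V p) y) (0, e, gradient u y) = 0 := by
  have h1 : ((0, e, gradient u y) : Euc d × Euc d × Euc d)
      = (0, 0, gradient u y) + (0, e, 0) := by simp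
  rw [hV.inner_gradient_ham, hV.deriv_ham, h1, map_add]
  constructor <;> intro h2 <;> linarith

lemma exists_hasDerivAt (hV : IsCellFamily a δ B h V) (ha : a.PosDef) (hδ : 0 < δ)
    {e : Euc d} (he : ‖e‖ = 1) :
    ∃ W : Euc d → Euc d → ℝ, (∀ p, ContDiff ℝ 2 (W p)) ∧ (∀ p, IsPeriodic (W p)) ∧
      (Continuous fun z : Euc d × Euc d => W z.1 z.2) ∧
      (Continuous fun z : Euc d × Euc d => fderiv ℝ (W z.1) z.2) ∧
      (∀ p y, HasDerivAt (fun t : ℝ => V (p + t • e) y) (W p y) 0) ∧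
      (∀ p y, HasDerivAt (fun t : ℝ => fderiv ℝ (V (p + t • e)) y) (fderiv ℝ (W p) y) 0) ∧
      ∀ p y, δ * W p y - trAH a (W p) y
        + fderiv ℝ h (y, p, gradient (V p) y) (0, e, gradient (W p) y) = 0 := by
  choose W hW hWp hW0 hW1 hWe using fun p => hV.exists_limit_diffQuot ha hδ p he
  have hlip := hV.exists_linearized_lipschitz ha hδ he hW hWp hWe
  refine ⟨W, hW, hWp, ?_, ?_, fun p y => ?_, fun p y => ?_, hWe⟩
  · exact continuous_uncurry_of_lipschitz (fun p => (hW p).continuous)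
      fun p => (hlip p).imp fun C hC p' hp' y => (hC p' hp' y).1
  · exact continuous_uncurry_of_lipschitz
      (fun p => (contDiff_fderiv_of_contDiff_two (hW p)).continuous)
      fun p => (hlip p).imp fun C hC p' hp' y => (hC p' hp' y).2
  · rw [hasDerivAt_iff_tendsto_slope_zero]
    simpa [diffQuot] using hW0 p y
  · rw [hasDerivAt_iff_tendsto_slope_zero]
    simpa [hV.fderiv_diffQuot] using hW1 p y

end IsCellFamily

end Hamiltonian

/-- Differentiability in `p` of the solution `v^δ(p, ·)` of the discounted cell
problem: the partial derivative `∂_{p_i} v^δ` exists everywhere, is continuous in `(p,y)`, is the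
unique classical solution of the linearized equation, and the mixed second derivatives
`D²_{py} v^δ` and `D²_{yp} v^δ` exist, are continuous and coincide. -/
theorem discounted_solution_p_differentiability (d : ℕ)
    -- `a = σ₂σ₂ᵀ + σ_{0,2}σ_{0,2}ᵀ` is a constant symmetric positive definite matrix
    (a : Matrix (Fin d) (Fin d) ℝ) (ha : a.PosDef) (haS : a.IsSymm)
    -- `A ⊂ ℝ^{2d}` is a compact set of controls
    (A : Set (Euc (2*d))) (hA : IsCompact A)
    -- the data `c, f, L`, continuous and Lipschitz in `(x,y,μ)` uniformly in `α ∈ A`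
    (c f : Torus d → Torus d → Euc (2*d) → ProbT d → Euc d)
    (L : Torus d → Torus d → Euc (2*d) → ProbT d → ℝ)
    (hccont : ∀ μ, Continuous fun z : Torus d × Torus d × Euc (2*d) => c z.1 z.2.1 z.2.2 μ)
    (hfcont : ∀ μ, Continuous fun z : Torus d × Torus d × Euc (2*d) => f z.1 z.2.1 z.2.2 μ)
    (hLcont : ∀ μ, Continuous fun z : Torus d × Torus d × Euc (2*d) => L z.1 z.2.1 z.2.2 μ)
    (K : ℝ)
    (hclip : ∀ x x' y y' α μ μ', α ∈ A →
      ‖c x y α μ - c x' y' α μ'‖ ≤ K * (dist x x' + dist y y' + W1T μ μ'))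
    (hflip : ∀ x x' y y' α μ μ', α ∈ A →
      ‖f x y α μ - f x' y' α μ'‖ ≤ K * (dist x x' + dist y y' + W1T μ μ'))
    (hLlip : ∀ x x' y y' α μ μ', α ∈ A →
      |L x y α μ - L x' y' α μ'| ≤ K * (dist x x' + dist y y' + W1T μ μ'))
    -- the Bellman Hamiltonian
    (H : Torus d → Torus d → Euc d → Euc d → ProbT d → ℝ)
    (hHdef : ∀ x y p q μ,
      H x y p q μ =
        sSup ((fun α => -⟪p, c x y α μ⟫ - ⟪q, f x y α μ⟫ - L x y α μ) '' A))
    (C_H β : ℝ) (hβ0 : 0 < β) (hβ1 : β < 1)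
    (hHC2 : ∀ μ, ContDiff ℝ 2
      (fun z : Euc d × Euc d × Euc d × Euc d =>
        H (Torus.proj z.1) (Torus.proj z.2.1) z.2.2.1 z.2.2.2 μ))
    -- with second derivative locally β-Hölder continuous uniformly in `μ`
    (hHholder : ∀ R : ℝ, 0 < R → ∃ C : ℝ, ∀ μ, ∀ z z' : Euc d × Euc d × Euc d × Euc d,
      ‖z‖ ≤ R → ‖z'‖ ≤ R →
      ‖iteratedFDeriv ℝ 2 (fun w : Euc d × Euc d × Euc d × Euc d =>
          H (Torus.proj w.1) (Torus.proj w.2.1) w.2.2.1 w.2.2.2 μ) z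
        - iteratedFDeriv ℝ 2 (fun w : Euc d × Euc d × Euc d × Euc d =>
          H (Torus.proj w.1) (Torus.proj w.2.1) w.2.2.1 w.2.2.2 μ) z'‖
        ≤ C * ‖z - z'‖ ^ β)
    -- `|D_x H| ≤ C_H (1+|p|)` and `|D_p H| ≤ C_H (1+|p|)`
    (hDx : ∀ (x : Euc d) (y : Torus d) (p q : Euc d) (μ : ProbT d),
      ‖fderiv ℝ (fun x' : Euc d => H (Torus.proj x') y p q μ) x‖ ≤ C_H * (1 + ‖p‖))
    (hDp : ∀ (x y : Torus d) (p q : Euc d) (μ : ProbT d),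
      ‖fderiv ℝ (fun p' : Euc d => H x y p' q μ) p‖ ≤ C_H * (1 + ‖p‖))
    (δ : ℝ) (hδ : 0 < δ) (x : Torus d) (μ : ProbT d)
    (v : Euc d → Torus d → ℝ)
    (hv : ∀ p : Euc d, IsSol a H δ x p μ (v p))
    (i : Fin d) :
    ∃ w : Euc d → Torus d → ℝ,
      -- `∂_{p_i} v^δ` is continuous in `(p,y)`
      Continuous (fun z : Euc d × Torus d => w z.1 z.2) ∧
      -- the partial derivative `∂_{p_i} v^δ(p,y)` exists for all `(p,y)` and equals `w(p,y)`
      (∀ (p : Euc d) (y : Euc d),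
        HasDerivAt
          (fun t : ℝ => v (p + t • (EuclideanSpace.single i 1 : Euc d)) (Torus.proj y))
          (w p (Torus.proj y)) 0) ∧
      -- for each `p`, `w(p,·)` is the unique classical solution of the linearized equation
      (∀ p : Euc d,
        LinSolP a H δ x μ v i p (w p) ∧
        ∀ u : Torus d → ℝ, LinSolP a H δ x μ v i p u → u = w p) ∧
      -- the mixed derivatives `∂_{y_j}∂_{p_i} v^δ` and `∂_{p_i}∂_{y_j} v^δ` exist, are
      -- continuous and coincide
      (∀ j : Fin d, ∃ m : Euc d → Euc d → ℝ,
        Continuous (fun z : Euc d × Euc d => m z.1 z.2) ∧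
        (∀ p y : Euc d,
          HasDerivAt
            (fun t : ℝ => w p (Torus.proj (y + t • (EuclideanSpace.single j 1 : Euc d))))
            (m p y) 0) ∧
        (∀ p y : Euc d,
          HasDerivAt
            (fun t : ℝ => deriv (fun s : ℝ =>
              v (p + t • (EuclideanSpace.single i 1 : Euc d))
                (Torus.proj (y + s • (EuclideanSpace.single j 1 : Euc d)))) 0)
            (m p y) 0)) := by
  obtain ⟨x₀, rfl⟩ := Torus.proj_surjective x
  obtain ⟨B, hB0, hB⟩ := exists_bellman_lipschitz hA
    (c := fun y α => c (Torus.proj x₀) y α μ) (f := fun y α => f (Torus.proj x₀) y α μ)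
    (L := fun y α => L (Torus.proj x₀) y α μ)
    ((hccont μ).comp (Continuous.prodMk_right (Torus.proj x₀)))
    ((hfcont μ).comp (Continuous.prodMk_right (Torus.proj x₀)))
    ((hLcont μ).comp (Continuous.prodMk_right (Torus.proj x₀)))
  set h : Euc d × Euc d × Euc d → ℝ :=
    fun z => H (Torus.proj x₀) (Torus.proj z.1) z.2.1 z.2.2 μ with hh
  have hV : IsCellFamily a δ B h fun p => tlift (v p) :=
    { nonneg := hB0
      contDiff_ham := (hHC2 μ).comp (contDiff_const.prodMk contDiff_id)
      periodic_ham := fun k hk y z => by simp only [hh, Torus.proj_add, hk, add_zero]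
      lipschitz_ham := fun y z z' => by
        simp only [hh, hHdef]
        exact hB (Torus.proj y) z z'
      contDiff := fun p => (hv p).1
      periodic := fun p => Torus.IsPeriodic.tlift (v p)
      eq := fun p => (hv p).2 }
  have he : ‖(EuclideanSpace.single i 1 : Euc d)‖ = 1 := by simp
  obtain ⟨W, hW, hWp, hWc, hWc', hd, hd', hWe⟩ := hV.exists_hasDerivAt ha hδ he
  choose w hw using fun p => (hWp p).exists_tlift_eq
  have hw' : ∀ p y, w p (Torus.proj y) = W p y := fun p y => congrFun (hw p) y
  refine ⟨w, ?_, fun p y => (hw' p y).symm ▸ hd p y, fun p => ⟨⟨(hw p).symm ▸ hW p, fun y => ?_⟩,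
    fun u hu => ?_⟩, fun j => ⟨fun p y => fderiv ℝ (W p) y (EuclideanSpace.single j 1), ?_,
      fun p y => ?_, fun p y => ?_⟩⟩
  · rw [← (IsOpenQuotientMap.id.prodMap Torus.isOpenQuotientMap_proj).continuous_comp_iff]
    simpa [Function.comp_def, hw'] using hWc
  · rw [hw p, hw' p]
    exact (hV.linearized_iff p _ (W p) y).2 (hWe p y)
  · funext Y
    obtain ⟨y, rfl⟩ := Torus.proj_surjective Y
    rw [hw']
    exact hV.eq_of_linearized ha hδ hu.1 (hW p) (Torus.IsPeriodic.tlift u) (hWp p)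
      (fun y => (hV.linearized_iff p _ (tlift u) y).1 (hu.2 y)) (hWe p) y
  · exact hWc'.clm_apply continuous_const
  · simp only [hw']
    simpa using hasDerivAt_line (differentiable_of_contDiff_two (hW p)) y
      (EuclideanSpace.single j 1) 0
  · have h1 : ∀ t : ℝ, deriv (fun s : ℝ => v (p + t • EuclideanSpace.single i 1)
        (Torus.proj (y + s • EuclideanSpace.single j 1))) 0
          = fderiv ℝ (tlift (v (p + t • EuclideanSpace.single i 1))) y
            (EuclideanSpace.single j 1) := fun t => by
      have h2 := (hasDerivAt_line (differentiable_of_contDiff_two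
        (hv (p + t • EuclideanSpace.single i 1)).1) y (EuclideanSpace.single j 1) 0).deriv
      rw [zero_smul, add_zero] at h2
      exact h2
    simp only [h1]
    simpa using (hd' p y).clm_apply (hasDerivAt_const (0 : ℝ) (EuclideanSpace.single j (1 : ℝ)))
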